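/- Suppose I can be written as I = (f1', f2', f3') where f1', f2', f3' are forms of degree 3 and (f1', f2') ⊆ (g) for some non-unit g ∈ R. Then pd(R/I) ≤ 4. -/

import Mathlib

open MvPolynomial Filter CategoryTheory

noncomputable section

/-- The height of an ideal `J`: the infimum of the heights of the prime ideals containing it. -/
def idealHeight {R : Type} [CommRing R] (J : Ideal R) : ℕ∞ :=
  ⨅ p ∈ {p : {q : Ideal R // q.IsPrime} | J ≤ p.1}, Order.height p

/-- `pdQuotLE J n` holds iff `R ⧸ J` admits a projective resolution of length at most `n`,
i.e. the projective dimension of `R ⧸ J` as an `R`-module is at most `n`. -/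
def pdQuotLE {R : Type} [CommRing R] (J : Ideal R) (n : ℕ) : Prop :=
  ∃ P : ProjectiveResolution (ModuleCat.of R (R ⧸ J)),
    ∀ i, n < i → Limits.IsZero (P.complex.X i)

/-- The `p`-primary component of `J` for `p` a minimal prime of `J`:
the saturation of `J` at `p`. -/
def primaryComponent {R : Type} [CommRing R] (J p : Ideal R) : Ideal R :=
  ⨆ (s : R) (_ : s ∉ p), Submodule.colon J (Ideal.span {s})

/-- The unmixed part `J^un` of `J`: the intersection of the primary components of `J`
corresponding to the minimal primes of `J` of minimal height. -/
def unmixedPart {R : Type} [CommRing R] (J : Ideal R) : Ideal R :=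
  ⨅ p ∈ {p : Ideal R | p.IsPrime ∧ J ≤ p ∧ idealHeight p = idealHeight J},
    primaryComponent J p

/-- A linear prime: a prime ideal generated by forms of degree one. -/
def IsLinearPrime {k : Type} [CommSemiring k] {N : ℕ} (p : Ideal (MvPolynomial (Fin N) k)) : Prop :=
  p.IsPrime ∧ ∃ S : Set (MvPolynomial (Fin N) k), (∀ ℓ ∈ S, ℓ.IsHomogeneous 1) ∧ p = Ideal.span S

/-- A homogeneous ideal: an ideal generated by homogeneous elements. -/
def IsHomogeneousIdeal {k : Type} [CommSemiring k] {N : ℕ}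
    (J : Ideal (MvPolynomial (Fin N) k)) : Prop :=
  ∃ S : Set (MvPolynomial (Fin N) k), (∀ g ∈ S, ∃ d, g.IsHomogeneous d) ∧ J = Ideal.span S

/-- `[B]_n`: the ideal generated by all forms of degree `n` belonging to `B`. -/
def degreePart {k : Type} [CommSemiring k] {N : ℕ} (B : Ideal (MvPolynomial (Fin N) k)) (n : ℕ) :
    Ideal (MvPolynomial (Fin N) k) :=
  Ideal.span {f | f ∈ B ∧ f.IsHomogeneous n}

/-- The Hilbert–Samuel function of `R/J` with respect to the irrelevant maximal ideal:
`n ↦ length (R / (J + 𝔪^n)) = dim_k (R / (J + 𝔪^n))`. -/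
def hilbertSamuelFn {k : Type} [Field k] {N : ℕ} (J : Ideal (MvPolynomial (Fin N) k))
    (n : ℕ) : ℕ :=
  Module.finrank k
    (MvPolynomial (Fin N) k ⧸
      (J ⊔ (Ideal.span (Set.range (MvPolynomial.X : Fin N → MvPolynomial (Fin N) k))) ^ n))

/-- `HasMultiplicity J d e`: the quotient `R/J` has Krull dimension `d` and Hilbert–Samuel
multiplicity `e`, expressed through the asymptotics `d! · HS_J(n) / n^d → e` of the
Hilbert–Samuel function. -/
def HasMultiplicity {k : Type} [Field k] {N : ℕ} (J : Ideal (MvPolynomial (Fin N) k))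
    (d e : ℕ) : Prop :=
  Tendsto (fun n : ℕ => (Nat.factorial d : ℝ) * (hilbertSamuelFn J n : ℝ) / (n : ℝ) ^ d)
    atTop (nhds (e : ℝ))

/-- An ideal of `R` is extended from a subalgebra `A` if it is generated by elements of `A`. -/
def extendedFrom {k R : Type} [CommRing k] [CommRing R] [Algebra k R]
    (K : Ideal R) (A : Subalgebra k R) : Prop :=
  ∃ S : Set R, S ⊆ (A : Set R) ∧ K = Ideal.span S

/-- Projective dimension at most `n`. -/
def PDL (R : Type) [CommRing R] (M : Type) [AddCommGroup M] [Module R M] (n : ℕ) : Prop :=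
  HasProjectiveDimensionLT (ModuleCat.of R M) (n + 1)

section PD
variable {R : Type} [CommRing R]
  {M N P : Type} [AddCommGroup M] [Module R M] [AddCommGroup N] [Module R N]
  [AddCommGroup P] [Module R P]

def sesOf (f : M →ₗ[R] N) (g : N →ₗ[R] P) (h : Function.Exact f g) : ShortComplex (ModuleCat R) :=
  ShortComplex.mk (ModuleCat.ofHom f) (ModuleCat.ofHom g) (by
    ext x; simpa using h.apply_apply_eq_zero x)

lemma sesOf_shortExact (f : M →ₗ[R] N) (g : N →ₗ[R] P) (h : Function.Exact f g)
    (hf : Function.Injective f) (hg : Function.Surjective g) : (sesOf f g h).ShortExact where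
  exact := by
    exact (ShortComplex.ShortExact.moduleCat_exact_iff_function_exact _).2 h
  mono_f := (ModuleCat.mono_iff_injective _).2 hf
  epi_g := (ModuleCat.epi_iff_surjective _).2 hg

lemma PDL.mono {n m : ℕ} (h : PDL R M n) (hnm : n ≤ m) : PDL R M m := by
  unfold PDL at *
  exact hasProjectiveDimensionLT_of_ge _ (n+1) (m+1) (by omega)

lemma PDL.of_equiv (e : M ≃ₗ[R] N) {n : ℕ} (h : PDL R M n) : PDL R N n := by
  unfold PDL at *
  exact hasProjectiveDimensionLT_of_iso (LinearEquiv.toModuleIso e) _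

lemma PDL.of_projective [Module.Projective R M] (n : ℕ) : PDL R M n := by
  refine PDL.mono (n := 0) ?_ (Nat.zero_le _)
  unfold PDL
  rw [zero_add, ← projective_iff_hasProjectiveDimensionLT_one, ← IsProjective.iff_projective]
  infer_instance

lemma pdl_mid (f : M →ₗ[R] N) (g : N →ₗ[R] P) (h : Function.Exact f g)
    (hf : Function.Injective f) (hg : Function.Surjective g) {n : ℕ}
    (h1 : PDL R M n) (h3 : PDL R P n) : PDL R N n :=
  (sesOf_shortExact f g h hf hg).hasProjectiveDimensionLT_X₂ _ h1 h3

lemma pdl_right (f : M →ₗ[R] N) (g : N →ₗ[R] P) (h : Function.Exact f g)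
    (hf : Function.Injective f) (hg : Function.Surjective g) {n : ℕ}
    (h1 : PDL R M n) (h2 : PDL R N (n + 1)) : PDL R P (n + 1) :=
  (sesOf_shortExact f g h hf hg).hasProjectiveDimensionLT_X₃ _ h1 h2

lemma pdl_left (f : M →ₗ[R] N) (g : N →ₗ[R] P) (h : Function.Exact f g)
    (hf : Function.Injective f) (hg : Function.Surjective g) {n : ℕ}
    (h2 : PDL R N n) (h3 : PDL R P (n + 1)) : PDL R M n :=
  (sesOf_shortExact f g h hf hg).hasProjectiveDimensionLT_X₁ _ h2 h3

/-- Projective dimension of `R ⧸ J` at most `n`. -/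
def PDI (J : Ideal R) (n : ℕ) : Prop := PDL R (R ⧸ J) n

lemma PDI.mono {J : Ideal R} {n m : ℕ} (h : PDI J n) (hnm : n ≤ m) : PDI J m := PDL.mono h hnm

/-- multiplication by `c` as a map `R/K → R/J`. -/
def mulQuot (J K : Ideal R) (c : R) (h : ∀ x, x ∈ K ↔ c * x ∈ J) : (R ⧸ K) →ₗ[R] (R ⧸ J) :=
  Submodule.mapQ K J (LinearMap.mulLeft R c) (fun x hx => (h x).1 hx)

lemma mulQuot_inj (J K : Ideal R) (c : R) (h : ∀ x, x ∈ K ↔ c * x ∈ J) :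
    Function.Injective (mulQuot J K c h) := by
  rw [← LinearMap.ker_eq_bot, LinearMap.ker_eq_bot']
  intro m hm
  obtain ⟨x, rfl⟩ := Ideal.Quotient.mk_surjective m
  have : Ideal.Quotient.mk J (c * x) = 0 := hm
  rw [Ideal.Quotient.eq_zero_iff_mem] at this ⊢
  exact (h x).2 this

lemma mulQuot_exact (J K : Ideal R) (c : R) (h : ∀ x, x ∈ K ↔ c * x ∈ J) :
    Function.Exact (mulQuot J K c h)
      (Submodule.mapQ J (J ⊔ Ideal.span {c}) LinearMap.id (fun _ hx => Ideal.mem_sup_left hx)) := by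
  intro m
  obtain ⟨x, rfl⟩ := Ideal.Quotient.mk_surjective m
  constructor
  · intro hm
    have : Ideal.Quotient.mk (J ⊔ Ideal.span {c}) x = 0 := hm
    rw [Ideal.Quotient.eq_zero_iff_mem, Submodule.mem_sup] at this
    obtain ⟨j, hj, z, hz, rfl⟩ := this
    obtain ⟨t, rfl⟩ := Ideal.mem_span_singleton'.1 hz
    refine ⟨Ideal.Quotient.mk K t, ?_⟩
    change Ideal.Quotient.mk J (c * t) = _
    rw [Ideal.Quotient.eq]
    have : c * t - (j + t * c) = -j := by ring
    rw [this]; exact J.neg_mem hj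
  · rintro ⟨y, hy⟩
    obtain ⟨t, rfl⟩ := Ideal.Quotient.mk_surjective y
    rw [← hy]
    change Ideal.Quotient.mk (J ⊔ Ideal.span {c}) (c * t) = 0
    rw [Ideal.Quotient.eq_zero_iff_mem]
    exact Ideal.mem_sup_right (Ideal.mul_mem_right _ _ (Ideal.mem_span_singleton_self c))

lemma mapQ_surj (J L : Ideal R) (h : J ≤ L) :
    Function.Surjective (Submodule.mapQ J L LinearMap.id h) := by
  intro m
  obtain ⟨x, rfl⟩ := Ideal.Quotient.mk_surjective m
  exact ⟨Ideal.Quotient.mk J x, rfl⟩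

lemma pdi_mid {J K : Ideal R} (c : R) (h : ∀ x, x ∈ K ↔ c * x ∈ J) {n : ℕ}
    (h1 : PDI K n) (h3 : PDI (J ⊔ Ideal.span {c}) n) : PDI J n :=
  pdl_mid _ _ (mulQuot_exact J K c h) (mulQuot_inj J K c h) (mapQ_surj _ _ _) h1 h3

lemma pdi_right {J K : Ideal R} (c : R) (h : ∀ x, x ∈ K ↔ c * x ∈ J) {n : ℕ}
    (h1 : PDI K n) (h3 : PDI J (n + 1)) : PDI (J ⊔ Ideal.span {c}) (n + 1) :=
  pdl_right _ _ (mulQuot_exact J K c h) (mulQuot_inj J K c h) (mapQ_surj _ _ _) h1 h3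

lemma pdi_left {J K : Ideal R} (c : R) (h : ∀ x, x ∈ K ↔ c * x ∈ J) {n : ℕ}
    (h1 : PDI J n) (h3 : PDI (J ⊔ Ideal.span {c}) (n + 1)) : PDI K n :=
  pdl_left _ _ (mulQuot_exact J K c h) (mulQuot_inj J K c h) (mapQ_surj _ _ _) h1 h3

lemma pdi_top (n : ℕ) : PDI (⊤ : Ideal R) n :=
  have : Subsingleton (R ⧸ (⊤ : Ideal R)) := Ideal.Quotient.subsingleton_iff.2 rfl
  PDL.of_projective n

lemma pdi_bot (n : ℕ) : PDI (⊥ : Ideal R) n :=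
  PDL.of_equiv (Submodule.quotEquivOfEqBot (⊥ : Ideal R) rfl).symm (PDL.of_projective n)

lemma pdi_regular {J : Ideal R} (c : R) (h : ∀ x, c * x ∈ J → x ∈ J) {n : ℕ}
    (h1 : PDI J n) : PDI (J ⊔ Ideal.span {c}) (n + 1) :=
  pdi_right (K := J) c (fun x => ⟨fun hx => J.mul_mem_left _ hx, h x⟩) h1 (h1.mono (Nat.le_succ _))

lemma pdi_span_singleton [IsDomain R] (a : R) (ha : a ≠ 0) : PDI (Ideal.span {a}) 1 := by
  have := pdi_regular (J := (⊥ : Ideal R)) a (by simp [ha]) (pdi_bot 0)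
  simpa using this

end PD


section Res
variable {C : Type 1} [Category.{0} C] [Abelian C]

/-- Elementary data of a projective resolution of length at most `n`. -/
def ResData (X : C) (n : ℕ) : Prop :=
  ∃ (K : ChainComplex C ℕ) (p : K.X 0 ⟶ X) (w : K.d 1 0 ≫ p = 0),
    (∀ i, Projective (K.X i)) ∧ (ShortComplex.mk (K.d 1 0) p w).Exact ∧ Epi p ∧
    (∀ i, K.ExactAt (i + 1)) ∧ ∀ i, n < i → Limits.IsZero (K.X i)

lemma ResData.toRes {X : C} {n : ℕ} (h : ResData X n) :
    ∃ P : ProjectiveResolution X, ∀ i, n < i → Limits.IsZero (P.complex.X i) := by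
  obtain ⟨K, p, w, h1, h2, h3, h4, h5⟩ := h
  let π : K ⟶ (ChainComplex.single₀ C).obj X := (ChainComplex.toSingle₀Equiv _ _).symm ⟨p, w⟩
  have hq : QuasiIso π := ⟨fun n => by
    cases n
    · rw [ChainComplex.quasiIsoAt₀_iff, ShortComplex.quasiIso_iff_of_zeros']
      · refine (ShortComplex.exact_and_epi_g_iff_of_iso ?_).2 ⟨h2, h3⟩
        refine ShortComplex.isoMk (Iso.refl _) (Iso.refl _) (Iso.refl _) ?_ ?_
        · change 𝟙 (K.X 1) ≫ K.d 1 0 = K.d 1 0 ≫ 𝟙 (K.X 0)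
          exact (Category.id_comp _).trans (Category.comp_id _).symm
        · change 𝟙 _ ≫ p = π.f 0 ≫ 𝟙 _
          rw [Category.id_comp]
          erw [Category.comp_id]
          exact (ChainComplex.toSingle₀Equiv_symm_apply_f_zero p w).symm
      · exact K.shape 0 0 (by simp)
      all_goals rfl
    · rw [quasiIsoAt_iff_exactAt']
      · apply h4
      · apply ChainComplex.exactAt_succ_single_obj⟩
  exact ⟨{ complex := K, projective := h1, π := π, quasiIso := hq }, h5⟩

lemma exact_augment (Q : ChainComplex C ℕ) {Y : C} (f : Q.X 0 ⟶ Y) (w : Q.d 1 0 ≫ f = 0)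
    (h0 : (ShortComplex.mk _ _ w).Exact) (h : ∀ i, Q.ExactAt (i + 1)) (i : ℕ) :
    (Q.augment f w).ExactAt (i + 1) := by
  rw [HomologicalComplex.exactAt_iff' _ (i + 1 + 1) (i + 1) i (by simp) (by simp)]
  cases i with
  | zero => exact h0
  | succ i =>
    have := h i
    rw [HomologicalComplex.exactAt_iff' _ (i + 1 + 1) (i + 1) i (by simp) (by simp)] at this
    exact this

lemma exists_resData [EnoughProjectives C] (n : ℕ) :
    ∀ (X : C), HasProjectiveDimensionLT X (n + 1) → ResData X n := by
  induction n with
  | zero =>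
    intro X hX
    have : Projective X := projective_iff_hasProjectiveDimensionLT_one.2 hX
    have hd : ((ChainComplex.single₀ C).obj X).d 1 0 = 0 :=
      (HomologicalComplex.isZero_single_obj_X _ _ _ _ (by omega)).eq_of_src _ _
    have h0 : ((ChainComplex.single₀ C).obj X).d 1 0 ≫ (𝟙 X : _ ⟶ X) = 0 := by
      rw [hd]; exact Limits.zero_comp
    refine ⟨(ChainComplex.single₀ C).obj X, 𝟙 X, h0, ?_, ?_, ?_, ?_, ?_⟩
    · intro i
      cases i with
      | zero => exact this
      | succ i => exact (HomologicalComplex.isZero_single_obj_X _ _ _ _ (by omega)).projective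
    · rw [ShortComplex.exact_iff_mono _ hd]
      exact (inferInstance : Mono (𝟙 X))
    · exact (inferInstance : Epi (𝟙 X))
    · intro i
      apply ChainComplex.exactAt_succ_single_obj
    · intro i hi
      exact HomologicalComplex.isZero_single_obj_X _ _ _ _ (by omega)
  | succ n ih =>
    intro X hX
    let S : ShortComplex C := ShortComplex.mk (Limits.kernel.ι (Projective.π X)) (Projective.π X)
      (by simp)
    have hS : S.ShortExact :=
      { exact := ShortComplex.exact_of_f_is_kernel _ (Limits.kernelIsKernel _)
        mono_f := by dsimp [S]; infer_instance
        epi_g := by dsimp [S]; infer_instance }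
    have hP : Projective S.X₂ := by dsimp [S]; infer_instance
    have hK : HasProjectiveDimensionLT S.X₁ (n + 1) :=
      hS.hasProjectiveDimensionLT_X₁ (n + 1)
        (hasProjectiveDimensionLT_of_ge _ 1 _ (by omega)) hX
    obtain ⟨Q, p, w, h1, h2, h3, h4, h5⟩ := ih S.X₁ hK
    have hm := hS.mono_f
    have w' : Q.d 1 0 ≫ (p ≫ S.f) = 0 := by
      rw [← Category.assoc, w, Limits.zero_comp]
    have e2 : (ShortComplex.mk _ _ w').Exact := by
      let α : ShortComplex.mk _ _ w ⟶ ShortComplex.mk _ _ w' :=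
        { τ₁ := 𝟙 _
          τ₂ := 𝟙 _
          τ₃ := S.f }
      exact (ShortComplex.exact_iff_of_epi_of_isIso_of_mono α).1 h2
    have w2 : (p ≫ S.f) ≫ S.g = 0 := by rw [Category.assoc, S.zero, Limits.comp_zero]
    have e1 : (ShortComplex.mk _ _ w2).Exact := by
      let α : ShortComplex.mk _ _ w2 ⟶ S :=
        { τ₁ := p
          τ₂ := 𝟙 _
          τ₃ := 𝟙 _ }
      exact (ShortComplex.exact_iff_of_epi_of_isIso_of_mono α).2 hS.exact
    refine ⟨Q.augment (p ≫ S.f) w', S.g, w2, ?_, e1, hS.epi_g, exact_augment _ _ _ e2 h4, ?_⟩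
    · intro i
      cases i with
      | zero => exact hP
      | succ i => exact h1 i
    · intro i hi
      cases i with
      | zero => omega
      | succ i => exact h5 i (by omega)

end Res

lemma PDI.pdQuotLE {R : Type} [CommRing R] {J : Ideal R} {n : ℕ} (h : PDI J n) : pdQuotLE J n :=
  (exists_resData n _ h).toRes

/-- `q` is a prime ideal whose quotient is a UFD. -/
structure UFDI {R : Type} [CommRing R] (q : Ideal R) : Prop where
  prime : q.IsPrime
  ufm : UniqueFactorizationMonoid (R ⧸ q)

section U
variable {R : Type} [CommRing R]

lemma UFDI.of_surj {q : Ideal R} {B : Type} [CommRing B] [IsDomain B]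
    [UniqueFactorizationMonoid B] (φ : R →+* B) (hφ : Function.Surjective φ)
    (hk : RingHom.ker φ = q) : UFDI q := by
  subst hk
  exact ⟨RingHom.ker_isPrime φ, (RingHom.quotientKerEquivOfSurjective hφ).symm.toMulEquiv.uniqueFactorizationMonoid inferInstance⟩

/-- reduced fractions in a UFD -/
lemma ufd_reduce {B : Type} [CommRing B] [IsDomain B] [UniqueFactorizationMonoid B]
    (b f : B) (hb : b ≠ 0) : ∃ b' f' e : B, b = b' * e ∧ f = f' * e ∧ b' ≠ 0 ∧ e ≠ 0 ∧ 
      IsRelPrime b' f' := by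
  obtain ⟨b', f', e, h1, h2, h3⟩ := UniqueFactorizationMonoid.exists_reduced_factors b hb f
  subst h2; subst h3
  refine ⟨b', f', e, mul_comm _ _, mul_comm _ _, ?_, ?_, h1⟩
  · rintro rfl; simp at hb
  · rintro rfl; simp at hb

lemma relprime_syz {B : Type} [CommRing B] [IsDomain B] [UniqueFactorizationMonoid B]
    {b' f' x y : B} (hb : b' ≠ 0) (h : IsRelPrime b' f') (hxy : b' * x = f' * y) :
    ∃ t, x = f' * t ∧ y = b' * t := by
  have : b' ∣ y := h.dvd_of_dvd_mul_left ⟨x, hxy.symm⟩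
  obtain ⟨t, rfl⟩ := this
  refine ⟨t, mul_left_cancel₀ hb ?_, rfl⟩
  rw [hxy]; ring

lemma UFDI.reduce {q : Ideal R} (hq : UFDI q) (b f : R) (hb : b ∉ q) :
    ∃ b' f' e : R, b - b' * e ∈ q ∧ f - f' * e ∈ q ∧ b' ∉ q ∧ e ∉ q ∧
      (∀ x y, b' * x - f' * y ∈ q → ∃ t, x - f' * t ∈ q ∧ y - b' * t ∈ q) := by
  have := hq.prime
  have := hq.ufm
  obtain ⟨b', f', e, h1, h2, h3, h4, h5⟩ := ufd_reduce (Ideal.Quotient.mk q b)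
    (Ideal.Quotient.mk q f) (by rwa [Ne, Ideal.Quotient.eq_zero_iff_mem])
  obtain ⟨b', rfl⟩ := Ideal.Quotient.mk_surjective b'
  obtain ⟨f', rfl⟩ := Ideal.Quotient.mk_surjective f'
  obtain ⟨e, rfl⟩ := Ideal.Quotient.mk_surjective e
  refine ⟨b', f', e, ?_, ?_, ?_, ?_, ?_⟩
  · rw [← Ideal.Quotient.eq, h1, map_mul]
  · rw [← Ideal.Quotient.eq, h2, map_mul]
  · rwa [Ne, Ideal.Quotient.eq_zero_iff_mem] at h3
  · rwa [Ne, Ideal.Quotient.eq_zero_iff_mem] at h4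
  · intro x y hxy
    rw [← Ideal.Quotient.eq, map_mul, map_mul] at hxy
    obtain ⟨t, ht1, ht2⟩ := relprime_syz h3 h5 hxy
    obtain ⟨t, rfl⟩ := Ideal.Quotient.mk_surjective t
    refine ⟨t, ?_, ?_⟩
    · rw [← Ideal.Quotient.eq, ht1, map_mul]
    · rw [← Ideal.Quotient.eq, ht2, map_mul]

lemma mem_sup_span {q : Ideal R} {b x : R} : x ∈ q ⊔ Ideal.span {b} ↔ ∃ t, x - b * t ∈ q := by
  rw [Submodule.mem_sup]
  constructor
  · rintro ⟨y, hy, z, hz, rfl⟩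
    obtain ⟨t, rfl⟩ := Ideal.mem_span_singleton'.1 hz
    exact ⟨t, by convert hy using 1; ring⟩
  · rintro ⟨t, ht⟩
    exact ⟨_, ht, b * t, Ideal.mul_mem_right _ _ (Ideal.mem_span_singleton_self b), by ring⟩

lemma mem_cancel {q : Ideal R} (hq : q.IsPrime) {e x : R} (he : e ∉ q) (h : e * x ∈ q) : x ∈ q :=
  (hq.mem_or_mem h).resolve_left he

/-- colon of `q + (b)` by `f` given reduced data -/
lemma colon_of_reduce {q : Ideal R} (hq : q.IsPrime) {b f b' f' e : R}
    (h1 : b - b' * e ∈ q) (h2 : f - f' * e ∈ q) (he : e ∉ q)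
    (h5 : ∀ x y, b' * x - f' * y ∈ q → ∃ t, x - f' * t ∈ q ∧ y - b' * t ∈ q) (x : R) :
    x ∈ q ⊔ Ideal.span {b'} ↔ f * x ∈ q ⊔ Ideal.span {b} := by
  rw [mem_sup_span, mem_sup_span]
  constructor
  · rintro ⟨t, ht⟩
    refine ⟨f' * t, ?_⟩
    have := q.add_mem (q.sub_mem (q.mul_mem_right x h2) (q.mul_mem_right (f' * t) h1))
      (q.mul_mem_left (f' * e) ht)
    convert this using 1; ring
  · rintro ⟨t, ht⟩
    have : e * (b' * t - f' * x) ∈ q := by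
      have := q.sub_mem (q.sub_mem (q.mul_mem_right x h2) (q.mul_mem_right t h1)) ht
      convert this using 1; ring
    obtain ⟨s, hs1, hs2⟩ := h5 _ _ (mem_cancel hq he this)
    exact ⟨s, hs2⟩

lemma pdi_prime_sup {q : Ideal R} (hq : q.IsPrime) {b : R} (hb : b ∉ q) {n : ℕ} (h : PDI q n) :
    PDI (q ⊔ Ideal.span {b}) (n + 1) :=
  pdi_regular b (fun _ hx => mem_cancel hq hb hx) h

/-- `(q + b) : f` has small projective dimension if `R/q` is a UFD. -/
lemma UFDI.pdi_colon {q : Ideal R} (hq : UFDI q) {b f : R} (hb : b ∉ q) {n : ℕ} (h : PDI q n)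
    {J : Ideal R} (hJ : ∀ x, x ∈ J ↔ f * x ∈ q ⊔ Ideal.span {b}) : PDI J (n + 1) := by
  obtain ⟨b', f', e, h1, h2, h3, h4, h5⟩ := hq.reduce b f hb
  have : J = q ⊔ Ideal.span {b'} := by
    ext x; rw [hJ, colon_of_reduce hq.prime h1 h2 h4 h5]
  rw [this]
  exact pdi_prime_sup hq.prime h3 h

/-- `R/((a)+ (b) : f)` always has projective dimension at most three. -/
def Good {R : Type} [CommRing R] (a : R) : Prop :=
  ∀ b f : R, b ∉ Ideal.span {a} → ∀ J : Ideal R,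
    (∀ x, x ∈ J ↔ f * x ∈ Ideal.span {a} ⊔ Ideal.span {b}) → PDI J 3

lemma Good.of_ufdi [IsDomain R] {a : R} (ha : a ≠ 0) (h : UFDI (Ideal.span {a})) : Good a := by
  intro b f hb J hJ
  exact (h.pdi_colon hb (pdi_span_singleton a ha) hJ).mono (by omega)

end U


lemma PDI.transport {R R' : Type} [CommRing R] [CommRing R'] (e : R ≃+* R') {J : Ideal R}
    {J' : Ideal R'} (hJ : ∀ x, x ∈ J ↔ e x ∈ J') {n : ℕ} (h : PDI J' n) : PDI J n := by
  let i : (R' ⧸ J') ≃+* (R ⧸ J) := Ideal.quotientEquiv J' J e.symm (by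
    ext x
    rw [hJ, Ideal.mem_map_iff_of_surjective (e.symm : R' →+* R) e.symm.surjective]
    constructor
    · intro hx; exact ⟨e x, hx, by simp⟩
    · rintro ⟨y, hy, rfl⟩; simpa using hy)
  letI := RingHomInvPair.of_ringEquiv e.symm
  letI := RingHomInvPair.of_ringEquiv e.symm.symm
  let e' : (R' ⧸ J') ≃ₛₗ[(e.symm : R' →+* R)] (R ⧸ J) :=
    { i with
      map_smul' := by
        intro r x
        obtain ⟨x, rfl⟩ := Ideal.Quotient.mk_surjective x
        change Ideal.Quotient.mk J (e.symm (r * x)) = Ideal.Quotient.mk J (e.symm r * e.symm x)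
        rw [map_mul] }
  have : HasProjectiveDimensionLE (ModuleCat.of R' (R' ⧸ J')) n := h
  exact ModuleCat.hasProjectiveDimensionLE_of_semiLinearEquiv (M := ModuleCat.of R' (R' ⧸ J')) (N := ModuleCat.of R (R ⧸ J)) e.symm e' n

lemma mem_two {R : Type} [CommRing R] {a b x : R} : x ∈ Ideal.span {a} ⊔ Ideal.span {b} ↔
    ∃ s t, x = a * s + b * t := by
  rw [mem_sup_span]
  constructor
  · rintro ⟨t, ht⟩
    obtain ⟨s, hs⟩ := Ideal.mem_span_singleton'.1 ht
    exact ⟨s, t, by linear_combination -hs⟩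
  · rintro ⟨s, t, rfl⟩
    exact ⟨t, Ideal.mem_span_singleton'.2 ⟨s, by ring⟩⟩

lemma Good.transport {R R' : Type} [CommRing R] [CommRing R'] (e : R ≃+* R') {a : R}
    (h : Good (e a)) : Good a := by
  intro b f hb J hJ
  refine PDI.transport e (J' := J.map e) ?_ (h (e b) (e f) ?_ _ ?_)
  · intro x
    rw [Ideal.mem_map_iff_of_surjective _ e.surjective]
    constructor
    · intro hx; exact ⟨x, hx, rfl⟩
    · rintro ⟨y, hy, h⟩; rw [← e.injective h]; exact hy
  · rw [Ideal.mem_span_singleton] at hb ⊢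
    rwa [map_dvd_iff]
  · intro x
    rw [Ideal.mem_map_iff_of_surjective _ e.surjective]
    constructor
    · rintro ⟨y, hy, rfl⟩
      have := (hJ y).1 hy
      rw [mem_two] at this ⊢
      obtain ⟨s, t, hst⟩ := this
      exact ⟨e s, e t, by rw [← map_mul, hst]; simp⟩
    · intro hx
      refine ⟨e.symm x, ?_, by simp⟩
      rw [hJ]
      rw [mem_two] at hx ⊢
      obtain ⟨s, t, hst⟩ := hx
      refine ⟨e.symm s, e.symm t, ?_⟩
      apply e.injective
      simpa using hst

section HF
variable {σ K : Type} [CommRing K]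

/-- grading homomorphism -/
def grHom (w : σ → ℤ) : MvPolynomial σ K →+* LaurentPolynomial (MvPolynomial σ K) :=
  MvPolynomial.eval₂Hom (LaurentPolynomial.C.comp MvPolynomial.C)
    (fun i => LaurentPolynomial.C (X i) * LaurentPolynomial.T (w i))

lemma grHom_monomial (w : σ → ℤ) (d : σ →₀ ℕ) (c : K) :
    grHom w (monomial d c) = LaurentPolynomial.C (monomial d c) *
      LaurentPolynomial.T (Finsupp.weight w d) := by
  rw [grHom, coe_eval₂Hom, eval₂_monomial, monomial_eq (a := c)]
  simp only [Finsupp.prod, mul_pow, Finset.prod_mul_distrib, map_mul, map_prod, map_pow,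
    RingHom.comp_apply, LaurentPolynomial.T_pow]
  rw [mul_assoc]
  congr 2
  rw [Finsupp.weight_apply, Finsupp.sum]
  induction d.support using Finset.cons_induction with
  | empty => simp
  | cons a s h ih =>
    rw [Finset.prod_cons, Finset.sum_cons, ih, LaurentPolynomial.T_add, nsmul_eq_mul, mul_comm]

lemma grHom_coeff (w : σ → ℤ) (f : MvPolynomial σ K) (n : ℤ) :
    (grHom w f).coeff n = weightedHomogeneousComponent w n f := by
  classical
  induction f using MvPolynomial.induction_on' with
  | monomial d c =>
    rw [grHom_monomial, ← LaurentPolynomial.single_eq_C_mul_T,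
      weightedHomogeneousComponent_of_mem (n := Finsupp.weight w d)
        (isWeightedHomogeneous_monomial w d c rfl), AddMonoidAlgebra.coeff_single,
        Finsupp.single_apply]
    simp only [eq_comm]
  | add p q hp hq => rw [map_add, map_add, ← hp, ← hq]; rfl

lemma grHom_of_wh {w : σ → ℤ} {f : MvPolynomial σ K} {m : ℤ} (h : IsWeightedHomogeneous w f m) :
    grHom w f = LaurentPolynomial.C f * LaurentPolynomial.T m := by
  classical
  ext n : 2
  rw [grHom_coeff, ← LaurentPolynomial.single_eq_C_mul_T, weightedHomogeneousComponent_of_mem h,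
    AddMonoidAlgebra.coeff_single, Finsupp.single_apply]
  simp only [eq_comm]

lemma wh_of_grHom {w : σ → ℤ} {f g : MvPolynomial σ K} {m : ℤ}
    (h : grHom w f = LaurentPolynomial.C g * LaurentPolynomial.T m) :
    IsWeightedHomogeneous w f m := by
  classical
  intro d hd
  by_contra hne
  have h1 := grHom_coeff w f (Finsupp.weight w d)
  rw [h, ← LaurentPolynomial.single_eq_C_mul_T, AddMonoidAlgebra.coeff_single,
    Finsupp.single_eq_of_ne hne] at h1
  have h2 := congrArg (coeff d) h1
  rw [coeff_weightedHomogeneousComponent, if_pos rfl] at h2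
  exact hd h2.symm

lemma poly_mono_factor {B : Type} [CommRing B] [IsDomain B] {p q : Polynomial B} {c : B} {n : ℕ}
    (hc : c ≠ 0) (h : p * q = Polynomial.monomial n c) : ∃ i d, p = Polynomial.monomial i d := by
  have hne : p * q ≠ 0 := by rw [h]; simpa using hc
  have hp := left_ne_zero_of_mul hne
  have hq := right_ne_zero_of_mul hne
  have h1 := Polynomial.natDegree_mul hp hq
  have h2 := Polynomial.natTrailingDegree_mul hp hq
  rw [h, Polynomial.natDegree_monomial_eq _ hc] at h1
  rw [h, Polynomial.natTrailingDegree_monomial hc] at h2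
  have h3 := Polynomial.natTrailingDegree_le_natDegree p
  have h4 := Polynomial.natTrailingDegree_le_natDegree q
  refine ⟨p.natDegree, p.leadingCoeff, ?_⟩
  ext i
  rw [Polynomial.coeff_monomial]
  split_ifs with hi
  · rw [← hi]; rfl
  · rcases lt_or_gt_of_ne hi with h5 | h5
    · exact Polynomial.coeff_eq_zero_of_natDegree_lt h5
    · exact Polynomial.coeff_eq_zero_of_lt_natTrailingDegree (by omega)

/-- factors of nonzero weighted homogeneous polynomials are weighted homogeneous -/
lemma wh_factor [IsDomain K] {w : σ → ℤ} {f g : MvPolynomial σ K} {m : ℤ} (hne : f * g ≠ 0)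
    (h : IsWeightedHomogeneous w (f * g) m) : ∃ n, IsWeightedHomogeneous w f n := by
  have h1 := grHom_of_wh h
  rw [map_mul] at h1
  obtain ⟨a, p, hp⟩ := LaurentPolynomial.exists_T_pow (grHom w f)
  obtain ⟨b, q, hq⟩ := LaurentPolynomial.exists_T_pow (grHom w g)
  have h2 : Polynomial.toLaurent (p * q) =
      LaurentPolynomial.C (f * g) * LaurentPolynomial.T (m + a + b) := by
    rw [map_mul, hp, hq, LaurentPolynomial.T_add, LaurentPolynomial.T_add]
    linear_combination LaurentPolynomial.T (a : ℤ) * LaurentPolynomial.T (b : ℤ) * h1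
  obtain ⟨u, v, huv⟩ : ∃ u v : ℕ, m + a + b + u = v :=
    ⟨(-(m + a + b)).toNat, (m+a+b).toNat, by omega⟩
  have h3 : p * (q * Polynomial.X ^ u) = Polynomial.monomial v (f * g) := by
    apply Polynomial.toLaurent_injective
    rw [← mul_assoc, map_mul, h2, Polynomial.toLaurent_X_pow, Polynomial.toLaurent_C_mul_T, ← huv,
      mul_assoc, ← LaurentPolynomial.T_add]
  obtain ⟨i, d, rfl⟩ := poly_mono_factor hne h3
  refine ⟨i - a, wh_of_grHom (g := d) ?_⟩
  rw [Polynomial.toLaurent_C_mul_T] at hp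
  rw [sub_eq_add_neg, LaurentPolynomial.T_add, ← mul_assoc, hp, mul_assoc, ← LaurentPolynomial.T_add]
  simp

lemma isHomogeneous_iff_wh {f : MvPolynomial σ K} {n : ℕ} :
    f.IsHomogeneous n ↔ IsWeightedHomogeneous (fun _ => (1 : ℤ)) f n := by
  have key : ∀ d : σ →₀ ℕ, Finsupp.weight (fun _ => (1 : ℤ)) d = (Finsupp.weight (1 : σ → ℕ) d : ℕ) := by
    intro d
    rw [Finsupp.weight_apply, Finsupp.weight_apply, Finsupp.sum, Finsupp.sum]
    simp
  constructor
  · intro h d hd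
    rw [key, h hd]
  · intro h d hd
    have := h hd
    rw [key] at this
    exact_mod_cast this

/-- factors of forms are forms -/
lemma hom_factor [IsDomain K] {f g : MvPolynomial σ K} {m : ℕ} (hne : f * g ≠ 0)
    (h : (f * g).IsHomogeneous m) : ∃ i j, f.IsHomogeneous i ∧ g.IsHomogeneous j ∧ i + j = m := by
  have aux : ∀ f g : MvPolynomial σ K, f * g ≠ 0 → (f * g).IsHomogeneous m →
      ∃ i : ℕ, f.IsHomogeneous i := by
    intro f g hne h
    obtain ⟨n, hn⟩ := wh_factor hne (isHomogeneous_iff_wh.1 h)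
    obtain ⟨d, hd⟩ := exists_coeff_ne_zero (left_ne_zero_of_mul hne)
    have h1 := hn hd
    have : 0 ≤ n := by
      rw [← h1, Finsupp.weight_apply]
      apply Finset.sum_nonneg
      intro i hi; simp
    lift n to ℕ using this
    exact ⟨n, isHomogeneous_iff_wh.2 hn⟩
  obtain ⟨i, hi⟩ := aux f g hne h
  obtain ⟨j, hj⟩ := aux g f (by rwa [mul_comm]) (by rwa [mul_comm])
  exact ⟨i, j, hi, hj, (hi.mul hj).inj_right h hne⟩

lemma hom_zero_unit {K : Type} [Field K] {f : MvPolynomial σ K} (h : f.IsHomogeneous 0) (hne : f ≠ 0) : IsUnit f := by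
  have h1 := (totalDegree_eq_zero_iff_eq_C (p := f)).1 (by simpa using h.totalDegree hne)
  rw [h1]
  have : coeff 0 f ≠ 0 := by rintro h0; rw [h0] at h1; simp at h1; exact hne h1
  exact (isUnit_iff_ne_zero.2 this).map C

lemma hom_pos_not_unit [IsDomain K] {f : MvPolynomial σ K} {n : ℕ} (h : f.IsHomogeneous n) (hn : n ≠ 0) : ¬ IsUnit f := by
  intro hu
  obtain ⟨g, hg⟩ := hu.exists_right_inv
  obtain ⟨i, j, hi, hj, hij⟩ := hom_factor (f := f) (g := g) (m := 0) (by rw [hg]; simp) (by rw [hg]; exact isHomogeneous_one _ _)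
  have := h.inj_right hi hu.ne_zero
  omega

end HF

section Lin
variable {σ k : Type} [Field k]

lemma basisX_exists : ∃ b : Module.Basis σ k (homogeneousSubmodule σ k 1),
    ∀ i, (b i : MvPolynomial σ k) = X i := by
  have hli : LinearIndependent k (X : σ → MvPolynomial σ k) := by
    have := (basisMonomials σ k).linearIndependent.comp (fun i : σ => Finsupp.single i 1)
      (Finsupp.single_left_injective one_ne_zero)
    have h2 : (X : σ → MvPolynomial σ k) =
        ⇑(basisMonomials σ k) ∘ fun i => Finsupp.single i 1 := by
      funext i; simp [X]
    rw [h2]; exact this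
  let b := (Module.Basis.span hli).map (LinearEquiv.ofEq _ _
    (homogeneousSubmodule_one_eq_span_X (σ := σ) (R := k)).symm)
  exact ⟨b, fun i => by simp [b, Module.Basis.span_apply]⟩

lemma coord_exists {ι : Type} (v : ι → MvPolynomial σ k) (hv : ∀ i, (v i).IsHomogeneous 1)
    (hli : LinearIndependent k v) :
    ∃ (τ : Type) (e : MvPolynomial (ι ⊕ τ) k ≃ₐ[k] MvPolynomial σ k),
      (∀ i, e (X (Sum.inl i)) = v i) ∧ (∀ (f : MvPolynomial (ι ⊕ τ) k) n, f.IsHomogeneous n → (e f).IsHomogeneous n) ∧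
      (∀ (f : MvPolynomial σ k) n, f.IsHomogeneous n → (e.symm f).IsHomogeneous n) := by
  obtain ⟨bX, hbX⟩ := basisX_exists (σ := σ) (k := k)
  let v' : ι → homogeneousSubmodule σ k 1 := fun i => ⟨v i, hv i⟩
  have hli' : LinearIndependent k v' := by
    apply LinearIndependent.of_comp (homogeneousSubmodule σ k 1).subtype
    exact hli
  let b := Module.Basis.sumExtend hli'
  have hb : ∀ i, b (Sum.inl i) = v' i := by 
    intro i
    simp only [b, Module.Basis.sumExtend, Module.Basis.reindex_apply, Module.Basis.extend_apply_self]
    rfl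
  let e1 := SymmetricAlgebra.equivMvPolynomial bX
  let e2 := SymmetricAlgebra.equivMvPolynomial b
  have h1 : ∀ x : homogeneousSubmodule σ k 1, e1 (SymmetricAlgebra.ι k _ x) = x := by
    have : e1.toLinearMap ∘ₗ (SymmetricAlgebra.ι k _) = (homogeneousSubmodule σ k 1).subtype := by
      apply bX.ext
      intro i
      simp [e1, hbX]
    intro x
    exact LinearMap.congr_fun this x
  have h2 : ∀ x : homogeneousSubmodule σ k 1, (e2 (SymmetricAlgebra.ι k _ x)).IsHomogeneous 1 := by
    intro x
    rw [← mem_homogeneousSubmodule, ← b.linearCombination_repr x, Finsupp.linearCombination_apply,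
      Finsupp.sum, map_sum, map_sum]
    apply Submodule.sum_mem
    intro i hi
    rw [map_smul, map_smul]
    apply Submodule.smul_mem
    simp only [e2, SymmetricAlgebra.equivMvPolynomial_ι_apply]
    exact isHomogeneous_X k i
  let e := e2.symm.trans e1
  have he : ∀ i, e (X i) = b i := by
    intro i
    simp only [e, AlgEquiv.trans_apply, e2, SymmetricAlgebra.equivMvPolynomial_symm_X, h1]
  have hes : ∀ i, (e.symm (X i)).IsHomogeneous 1 := by
    intro i
    have : e.symm (X i) = e2 (SymmetricAlgebra.ι k _ (bX i)) := by
      rw [← hbX i, ← h1 (bX i)]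
      simp [e]
    rw [this]; exact h2 _
  refine ⟨_, e, ?_, ?_, ?_⟩
  · intro i; rw [he, hb]
  · intro f n hf
    have : e f = aeval (fun i => e (X i)) f := by
      rw [← AlgEquiv.coe_toAlgHom e]
      exact congrArg (fun h : _ →ₐ[k] _ => h f) (by ext i; simp)
    rw [this]
    have := hf.aeval (fun i => e (X i)) (fun i => by rw [he]; exact (b i).2)
    simpa using this
  · intro f n hf
    have : e.symm f = aeval (fun i => e.symm (X i)) f := by
      rw [← AlgEquiv.coe_toAlgHom e.symm]
      exact congrArg (fun h : _ →ₐ[k] _ => h f) (by ext i; simp)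
    rw [this]
    have := hf.aeval (fun i => e.symm (X i)) hes
    simpa using this

lemma sub_section_mem {B : Type} [CommRing B] [Algebra k B] (φ : MvPolynomial σ k →ₐ[k] B)
    (s : B →ₐ[k] MvPolynomial σ k) (I : Ideal (MvPolynomial σ k))
    (h : ∀ i, X i - s (φ (X i)) ∈ I) (x : MvPolynomial σ k) : x - s (φ x) ∈ I := by
  have : (Ideal.Quotient.mkₐ k I) = (Ideal.Quotient.mkₐ k I).comp (s.comp φ) := by
    ext i
    have := h i
    rw [← Ideal.Quotient.eq] at this
    simpa using this
  have := congrArg (fun h : _ →ₐ[k] _ => h x) this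
  rw [← Ideal.Quotient.eq]
  exact this

lemma lin_quot (l : MvPolynomial σ k) (hl : l.IsHomogeneous 1) (hne : l ≠ 0) :
    ∃ (τ : Type) (φ : MvPolynomial σ k →ₐ[k] MvPolynomial τ k)
      (s : MvPolynomial τ k →ₐ[k] MvPolynomial σ k),
      (∀ x, φ (s x) = x) ∧ (∀ x, φ x = 0 ↔ x ∈ Ideal.span {l}) ∧
      (∀ (f : MvPolynomial σ k) n, f.IsHomogeneous n → (φ f).IsHomogeneous n) ∧
      (∀ (f : MvPolynomial τ k) n, f.IsHomogeneous n → (s f).IsHomogeneous n) := by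
  obtain ⟨τ, e, h1, h2, h3⟩ := coord_exists (fun _ : Unit => l) (fun _ => hl)
    (by rw [linearIndependent_unique_iff]; exact hne)
  let π : MvPolynomial (Unit ⊕ τ) k →ₐ[k] MvPolynomial τ k := aeval (Sum.elim 0 X)
  let φ := π.comp e.symm.toAlgHom
  let s : MvPolynomial τ k →ₐ[k] MvPolynomial σ k := e.toAlgHom.comp (rename Sum.inr)
  have hπ : ∀ x, π (rename Sum.inr x) = x := by
    intro x
    simp only [π, aeval_rename, Sum.elim_comp_inr, aeval_X_left, AlgHom.id_apply]
  refine ⟨τ, φ, s, ?_, ?_, ?_, ?_⟩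
  · intro x; simp [φ, s, hπ]
  · intro x
    constructor
    · intro hx
      have := sub_section_mem π (rename Sum.inr) (Ideal.span {X (Sum.inl ())}) (by
        rintro (i | i)
        · simp [π]
        · simp [π]) (e.symm x)
      have hx' : π (e.symm x) = 0 := hx
      rw [hx', map_zero, sub_zero, Ideal.mem_span_singleton] at this
      have := map_dvd e this
      rw [h1, AlgEquiv.apply_symm_apply] at this
      exact Ideal.mem_span_singleton.2 this
    · intro hx
      obtain ⟨t, rfl⟩ := Ideal.mem_span_singleton'.1 hx
      have : e.symm l = X (Sum.inl ()) := by rw [AlgEquiv.symm_apply_eq, h1]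
      simp [φ, this, π]
  · intro f n hf
    have := (h3 f n hf).aeval (Sum.elim 0 X : Unit ⊕ τ → MvPolynomial τ k) (n := 1) (by
      rintro (i | i)
      · exact isHomogeneous_zero _ _ _
      · exact isHomogeneous_X _ _)
    rw [one_mul] at this
    exact this
  · intro f n hf
    exact h2 _ _ (hf.rename_isHomogeneous)

end Lin

section Red
variable {R : Type} [CommRing R]

/-- the colon ideal `I : f` -/
def colon1 (I : Ideal R) (f : R) : Ideal R := Submodule.comap (LinearMap.mulLeft R f) I

lemma mem_colon1 {I : Ideal R} {f x : R} : x ∈ colon1 I f ↔ f * x ∈ I := Iff.rfl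

/-- `b * T` -/
def scaled (b : R) (T : Ideal R) : Ideal R := Submodule.map (LinearMap.mulLeft R b) T

lemma mem_sup_scaled {q T : Ideal R} {b x : R} :
    x ∈ q ⊔ scaled b T ↔ ∃ t ∈ T, x - b * t ∈ q := by
  rw [Submodule.mem_sup]
  constructor
  · rintro ⟨y, hy, z, ⟨t, ht, rfl⟩, rfl⟩
    exact ⟨t, ht, by simpa using hy⟩
  · rintro ⟨t, ht, h⟩
    exact ⟨_, h, b * t, ⟨t, ht, rfl⟩, by ring⟩

lemma pdi_scaled {q T : Ideal R} (hq : q.IsPrime) {b : R} (hb : b ∉ q) (hqT : q ≤ T) {n : ℕ}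
    (h1 : PDI T n) (h2 : PDI (q ⊔ Ideal.span {b}) n) : PDI (q ⊔ scaled b T) n := by
  refine pdi_mid (K := T) b ?_ h1 ?_
  · intro x
    rw [mem_sup_scaled]
    constructor
    · intro hx; exact ⟨x, hx, by simp⟩
    · rintro ⟨t, ht, h⟩
      rw [← mul_sub] at h
      have := hqT (mem_cancel hq hb h)
      simpa using T.add_mem this ht
  · convert h2 using 1
    apply le_antisymm
    · refine sup_le (sup_le le_sup_left ?_) le_sup_right
      rintro _ ⟨t, ht, rfl⟩
      exact Ideal.mem_sup_right (Ideal.mul_mem_right _ _ (Ideal.mem_span_singleton_self b))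
    · exact sup_le (le_sup_left.trans le_sup_left) le_sup_right

lemma mem_three {m f b x : R} : x ∈ Ideal.span {m} ⊔ Ideal.span {f} ⊔ Ideal.span {b} ↔
    ∃ u p w, x = m * u + f * p + b * w := by
  rw [mem_sup_span]
  constructor
  · rintro ⟨t, ht⟩
    rw [mem_two] at ht
    obtain ⟨s, r, h⟩ := ht
    exact ⟨s, r, t, by linear_combination h⟩
  · rintro ⟨u, p, w, rfl⟩
    exact ⟨w, mem_two.2 ⟨u, p, by ring⟩⟩

lemma mem_sp1 {m x : R} : x ∈ Ideal.span {m} ↔ ∃ u, x = m * u := by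
  rw [Ideal.mem_span_singleton]; rfl

lemma red_B [IsDomain R] {l m b f b1 f1 g : R} (hl0 : l ≠ 0) (hm0 : m ≠ 0)
    (hl : UFDI (Ideal.span {l})) (hm : UFDI (Ideal.span {m}))
    (hbl : b ∉ Ideal.span {l}) (hbm : b ∉ Ideal.span {m})
    (h1 : b - b1 * g ∈ Ideal.span {m}) (h2 : f - f1 * g ∈ Ideal.span {m})
    (h4 : (∃ c, b1 * c - 1 ∈ Ideal.span {m}) ∨
      (b1 ∉ Ideal.span {m} ∧ UFDI (Ideal.span {m} ⊔ Ideal.span {b1})))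
    {J : Ideal R} (hJ : ∀ x, x ∈ J ↔ f * x ∈ Ideal.span {l * m} ⊔ Ideal.span {b}) : PDI J 3 := by
  have hg : g ∉ Ideal.span {m} := by
    intro hg
    apply hbm
    have := (Ideal.span {m}).add_mem h1 (Ideal.mul_mem_left _ b1 hg)
    simpa using this
  obtain ⟨b', f', e, r1, r2, r3, r4, r5⟩ := hl.reduce b f hbl
  have hD : b' * f - f' * b ∈ Ideal.span {l} := by
    have := (Ideal.span {l}).sub_mem (Ideal.mul_mem_left _ b' r2) (Ideal.mul_mem_left _ f' r1)
    convert this using 1; ring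
  obtain ⟨D, hD⟩ := mem_sp1.1 hD
  set T := colon1 (Ideal.span {m} ⊔ Ideal.span {f} ⊔ Ideal.span {b}) D with hT
  have hmT : Ideal.span {m} ≤ T := by
    rw [Ideal.span_singleton_le_iff_mem, mem_colon1, mem_three]
    exact ⟨D, 0, 0, by ring⟩
  have hlT : Ideal.span {l} ≤ T := by
    rw [Ideal.span_singleton_le_iff_mem, mem_colon1, mem_three]
    exact ⟨0, b', -f', by linear_combination -hD⟩
  -- the sum with l
  have hsum : J ⊔ Ideal.span {l} = Ideal.span {l} ⊔ scaled b' T := by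
    apply le_antisymm
    · refine sup_le ?_ le_sup_left
      intro s hs
      obtain ⟨u, v, huv⟩ := mem_two.1 ((hJ s).1 hs)
      obtain ⟨α, hα⟩ := mem_sp1.1 r1
      obtain ⟨β, hβ⟩ := mem_sp1.1 r2
      obtain ⟨t, ht1, ht2⟩ := r5 v s (mem_cancel hl.prime r4 (mem_sp1.2
        ⟨β * s - m * u - α * v, by linear_combination (-huv) + hβ * s - hα * v⟩))
      obtain ⟨v', hv'⟩ := mem_sp1.1 ht1
      obtain ⟨r, hr⟩ := mem_sp1.1 ht2
      rw [mem_sup_scaled]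
      refine ⟨t, ?_, ht2⟩
      rw [mem_colon1, mem_three]
      refine ⟨u, -r, v', mul_left_cancel₀ hl0 ?_⟩
      linear_combination -t * hD + huv - f * hr + b * hv'
    · refine sup_le le_sup_right ?_
      rintro _ ⟨t, ht, rfl⟩
      obtain ⟨u, p, w, h⟩ := mem_three.1 (mem_colon1.1 ht)
      rw [mem_sup_span]
      refine ⟨p, (hJ _).2 (mem_two.2 ⟨u, l * w + f' * t, ?_⟩)⟩
      simp only [LinearMap.mulLeft_apply]
      linear_combination l * h + t * hD
  -- the ideal T
  obtain ⟨g1, D1, d, s1, s2, s3, s4, s5⟩ := hm.reduce g D hg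
  set T' := colon1 (Ideal.span {m} ⊔ Ideal.span {f1} ⊔ Ideal.span {b1}) D1 with hT'
  have hmT' : Ideal.span {m} ≤ T' := by
    rw [Ideal.span_singleton_le_iff_mem, mem_colon1, mem_three]
    exact ⟨D1, 0, 0, by ring⟩
  obtain ⟨a1, ha1⟩ := mem_sp1.1 h1
  obtain ⟨a2, ha2⟩ := mem_sp1.1 h2
  obtain ⟨c1, hc1⟩ := mem_sp1.1 s1
  obtain ⟨c2, hc2⟩ := mem_sp1.1 s2
  have hTeq : T = Ideal.span {m} ⊔ scaled g1 T' := by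
    apply le_antisymm
    · intro t ht
      obtain ⟨u, p, w, h⟩ := mem_three.1 (mem_colon1.1 ht)
      -- d (D1 t - g1 (f1 p + b1 w)) ∈ (m)
      have : g1 * (f1 * p + b1 * w) - D1 * t ∈ Ideal.span {m} := by
        refine mem_cancel hm.prime s4 (mem_sp1.2
          ⟨-u - a2 * p - a1 * w - c1 * (f1 * p + b1 * w) + c2 * t, ?_⟩)
        linear_combination -h - ha2 * p - ha1 * w - hc1 * (f1 * p + b1 * w) + hc2 * t
      obtain ⟨s, hs1, hs2⟩ := s5 _ _ this
      rw [mem_sup_scaled]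
      refine ⟨s, ?_, hs2⟩
      obtain ⟨γ, hγ⟩ := mem_sp1.1 hs1
      rw [mem_colon1, mem_three]
      exact ⟨-γ, p, w, by linear_combination -hγ⟩
    · refine sup_le hmT ?_
      rintro _ ⟨t, ht, rfl⟩
      obtain ⟨u, p, w, h⟩ := mem_three.1 (mem_colon1.1 ht)
      rw [mem_colon1, mem_three]
      simp only [LinearMap.mulLeft_apply]
      refine ⟨c2 * g1 * t - c1 * D1 * t + g * u - a2 * p - a1 * w, p, w, ?_⟩
      linear_combination hc2 * g1 * t - hc1 * D1 * t + g * h - ha2 * p - ha1 * w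
  have hpm := pdi_span_singleton m hm0
  have hpl := pdi_span_singleton l hl0
  have hpT' : PDI T' 3 := by
    rcases h4 with ⟨c, hc⟩ | ⟨hb1, hQ⟩
    · have : T' = ⊤ := by
        rw [Ideal.eq_top_iff_one, mem_colon1, mem_three]
        obtain ⟨α, hα⟩ := mem_sp1.1 hc
        exact ⟨-α * D1, 0, c * D1, by linear_combination -D1 * hα⟩
      rw [this]; exact pdi_top 3
    · have hpQ : PDI (Ideal.span {m} ⊔ Ideal.span {b1}) 2 := pdi_prime_sup hm.prime hb1 hpm
      have hcomm : Ideal.span {m} ⊔ Ideal.span {f1} ⊔ Ideal.span {b1} =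
          Ideal.span {m} ⊔ Ideal.span {b1} ⊔ Ideal.span {f1} := sup_right_comm _ _ _
      by_cases hf1 : f1 ∈ Ideal.span {m} ⊔ Ideal.span {b1}
      · have h3 : Ideal.span {m} ⊔ Ideal.span {b1} ⊔ Ideal.span {f1} =
            Ideal.span {m} ⊔ Ideal.span {b1} := by
          rw [sup_eq_left, Ideal.span_singleton_le_iff_mem]; exact hf1
        by_cases hD1 : D1 ∈ Ideal.span {m} ⊔ Ideal.span {b1}
        · have : T' = ⊤ := by
            rw [Ideal.eq_top_iff_one, mem_colon1, hcomm, h3, mul_one]; exact hD1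
          rw [this]; exact pdi_top 3
        · have : T' = Ideal.span {m} ⊔ Ideal.span {b1} := by
            ext x
            rw [mem_colon1, hcomm, h3]
            exact ⟨fun h => mem_cancel hQ.prime hD1 h, fun h => Ideal.mul_mem_left _ _ h⟩
          rw [this]; exact hpQ.mono (by omega)
      · refine hQ.pdi_colon (f := D1) hf1 hpQ ?_
        intro x; rw [mem_colon1, hcomm]
  have hpT : PDI T 3 := by
    rw [hTeq]
    exact pdi_scaled hm.prime s3 hmT' hpT' ((pdi_prime_sup hm.prime s3 hpm).mono (by omega))
  refine pdi_mid (K := colon1 (Ideal.span {m} ⊔ Ideal.span {b}) f) l ?_ ?_ ?_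
  · intro x
    rw [mem_colon1, hJ, mem_two, mem_two]
    constructor
    · rintro ⟨u, v, h⟩; exact ⟨u, l * v, by linear_combination l * h⟩
    · rintro ⟨u, v, h⟩
      have : v ∈ Ideal.span {l} :=
        mem_cancel hl.prime hbl (mem_sp1.2 ⟨f * x - m * u, by linear_combination -h⟩)
      obtain ⟨v', rfl⟩ := mem_sp1.1 this
      exact ⟨u, v', mul_left_cancel₀ hl0 (by linear_combination h)⟩
  · exact (hm.pdi_colon hbm hpm (fun x => mem_colon1)).mono (by omega)
  · rw [hsum]
    exact pdi_scaled hl.prime r3 hlT hpT ((pdi_prime_sup hl.prime r3 hpl).mono (by omega))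

/-- `J = (lm, b)` when `f` and `b` are relatively prime modulo `l` and modulo `m`. -/
lemma red_A [IsDomain R] {l m b f : R} (hl0 : l ≠ 0) (hm0 : m ≠ 0)
    (hl : (Ideal.span {l}).IsPrime) (hm : (Ideal.span {m}).IsPrime)
    (hbl : b ∉ Ideal.span {l}) (hbm : b ∉ Ideal.span {m})
    (h1 : ∀ x, f * x ∈ Ideal.span {l} ⊔ Ideal.span {b} → x ∈ Ideal.span {l} ⊔ Ideal.span {b})
    (h2 : ∀ x, f * x ∈ Ideal.span {m} ⊔ Ideal.span {b} → x ∈ Ideal.span {m} ⊔ Ideal.span {b})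
    {J : Ideal R} (hJ : ∀ x, x ∈ J ↔ f * x ∈ Ideal.span {l * m} ⊔ Ideal.span {b}) : PDI J 3 := by
  have : J = Ideal.span {l * m} ⊔ Ideal.span {b} := by
    ext s
    rw [hJ]
    refine ⟨?_, fun h => Ideal.mul_mem_left _ _ h⟩
    intro h
    obtain ⟨u, v, huv⟩ := mem_two.1 h
    obtain ⟨s', t, hs⟩ := mem_two.1 (h2 s (mem_two.2 ⟨l * u, v, by linear_combination huv⟩))
    obtain ⟨v', hv'⟩ := mem_sp1.1 (mem_cancel hm hbm (x := v - t * f)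
      (mem_sp1.2 ⟨s' * f - l * u, by linear_combination -huv + f * hs⟩))
    obtain ⟨p, q, hpq⟩ := mem_two.1 (h1 s' (mem_two.2 ⟨u, v', mul_left_cancel₀ hm0
      (by linear_combination huv - f * hs + b * hv')⟩))
    exact mem_two.2 ⟨p, t + m * q, by linear_combination hs + m * hpq⟩
  rw [this]
  refine PDI.mono (n := 2) ?_ (by omega)
  refine pdi_regular b ?_ (pdi_span_singleton _ (mul_ne_zero hl0 hm0))
  intro x hx
  obtain ⟨u, hu⟩ := mem_sp1.1 hx
  obtain ⟨x', rfl⟩ := mem_sp1.1 (mem_cancel hl hbl (mem_sp1.2 ⟨m * u, by rw [hu]; ring⟩) : x ∈ Ideal.span {l})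
  have h3 : b * x' = m * u := mul_left_cancel₀ hl0 (by linear_combination hu)
  obtain ⟨x'', rfl⟩ := mem_sp1.1 (mem_cancel hm hbm (mem_sp1.2 ⟨u, h3⟩) : x' ∈ Ideal.span {m})
  exact mem_sp1.2 ⟨x'', by ring⟩

end Red

section RedPoly
variable {σ k : Type} [Field k]

lemma ufdi_lin {l : MvPolynomial σ k} (hl : l.IsHomogeneous 1) (h0 : l ≠ 0) :
    UFDI (Ideal.span {l}) := by
  obtain ⟨τ, φ, s, h1, h2, h3, h4⟩ := lin_quot l hl h0
  refine UFDI.of_surj (φ : MvPolynomial σ k →+* MvPolynomial τ k) (fun x => ⟨s x, h1 x⟩) ?_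
  ext x
  rw [RingHom.mem_ker]
  exact h2 x

lemma ufdi_lin2 {m b : MvPolynomial σ k} (hm : m.IsHomogeneous 1) (h0 : m ≠ 0)
    (hb : b.IsHomogeneous 1) (hbm : b ∉ Ideal.span {m}) :
    UFDI (Ideal.span {m} ⊔ Ideal.span {b}) := by
  obtain ⟨τ, φ, s, h1, h2, h3, h4⟩ := lin_quot m hm h0
  obtain ⟨τ', φ', s', h1', h2', h3', h4'⟩ := lin_quot (φ b) (h3 _ _ hb) (by rwa [Ne, h2])
  refine UFDI.of_surj ((φ'.comp φ : MvPolynomial σ k →ₐ[k] MvPolynomial τ' k) :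
    MvPolynomial σ k →+* MvPolynomial τ' k) (fun x => ⟨s (s' x), by simp [h1, h1']⟩) ?_
  ext x
  rw [RingHom.mem_ker]
  change φ' (φ x) = 0 ↔ _
  rw [h2', mem_sup_span, mem_sp1]
  constructor
  · rintro ⟨t, ht⟩
    exact ⟨s t, by rw [← h2, map_sub, map_mul, h1, ht, sub_self]⟩
  · rintro ⟨t, ht⟩
    rw [← h2, map_sub, map_mul, sub_eq_zero] at ht
    exact ⟨φ t, ht⟩

lemma lin_dichotomy {m b : MvPolynomial σ k} (f : MvPolynomial σ k) (hm : m.IsHomogeneous 1)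
    (h0 : m ≠ 0) (hb : b.IsHomogeneous 2) (hbm : b ∉ Ideal.span {m}) :
    (∀ x, f * x ∈ Ideal.span {m} ⊔ Ideal.span {b} → x ∈ Ideal.span {m} ⊔ Ideal.span {b}) ∨
    ∃ b1 f1 g, b - b1 * g ∈ Ideal.span {m} ∧ f - f1 * g ∈ Ideal.span {m} ∧
      ((∃ c, b1 * c - 1 ∈ Ideal.span {m}) ∨
      (b1 ∉ Ideal.span {m} ∧ UFDI (Ideal.span {m} ⊔ Ideal.span {b1}))) := by
  obtain ⟨τ, φ, s, h1, h2, h3, h4⟩ := lin_quot m hm h0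
  have hφb : φ b ≠ 0 := by rwa [Ne, h2]
  obtain ⟨b1, f1, e, r1, r2, r3, r4, r5⟩ := ufd_reduce (φ b) (φ f) hφb
  by_cases he : IsUnit e
  · left
    intro x hx
    obtain ⟨u, v, huv⟩ := mem_two.1 hx
    have hφm : φ m = 0 := (h2 m).2 (Ideal.mem_span_singleton_self m)
    have h5 := congrArg φ huv
    simp only [map_mul, map_add, hφm, r1, r2, zero_mul, zero_add] at h5
    obtain ⟨t, ht1, ht2⟩ := relprime_syz (x := φ v) (y := φ x) r3 r5
      (mul_left_cancel₀ r4 (by linear_combination -h5))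
    obtain ⟨e', he'⟩ := he.exists_right_inv
    rw [mem_sup_span]
    refine ⟨s (e' * t), ?_⟩
    rw [← h2, map_sub, map_mul, h1, ht2, r1]
    linear_combination -b1 * t * he'
  · right
    refine ⟨s b1, s f1, s e, ?_, ?_, ?_⟩
    · rw [← h2, map_sub, map_mul, h1, h1, r1, sub_self]
    · rw [← h2, map_sub, map_mul, h1, h1, r2, sub_self]
    · obtain ⟨i, j, hi, hj, hij⟩ := hom_factor (f := b1) (g := e) (m := 2) (by rwa [← r1])
        (by rw [← r1]; exact h3 _ _ hb)
      have hj0 : j ≠ 0 := by rintro rfl; exact he (hom_zero_unit hj r4)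
      have : i = 0 ∨ i = 1 := by omega
      rcases this with rfl | rfl
      · left
        obtain ⟨c, hc⟩ := (hom_zero_unit hi r3).exists_right_inv
        exact ⟨s c, by rw [← h2, map_sub, map_mul, h1, h1, hc, map_one, sub_self]⟩
      · right
        have : s b1 ∉ Ideal.span {m} := by rwa [← h2, h1]
        exact ⟨this, ufdi_lin2 hm h0 (h4 _ _ hi) this⟩

lemma reducible_case {l m b f : MvPolynomial σ k} (hl : l.IsHomogeneous 1) (hl0 : l ≠ 0)
    (hm : m.IsHomogeneous 1) (hm0 : m ≠ 0) (hb : b.IsHomogeneous 2)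
    (hbl : b ∉ Ideal.span {l}) (hbm : b ∉ Ideal.span {m})
    {J : Ideal (MvPolynomial σ k)}
    (hJ : ∀ x, x ∈ J ↔ f * x ∈ Ideal.span {l * m} ⊔ Ideal.span {b}) : PDI J 3 := by
  have ul := ufdi_lin hl hl0
  have um := ufdi_lin hm hm0
  rcases lin_dichotomy f hm hm0 hb hbm with h1 | ⟨b1, f1, g, h1, h2, h3⟩
  · rcases lin_dichotomy f hl hl0 hb hbl with h2 | ⟨b1, f1, g, h1, h2, h3⟩
    · exact red_A hl0 hm0 ul.prime um.prime hbl hbm h2 h1 hJ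
    · exact red_B hm0 hl0 um ul hbm hbl h1 h2 h3 (by rwa [mul_comm])
  · exact red_B hl0 hm0 ul um hbl hbm h1 h2 h3 hJ

end RedPoly

section Nag

lemma nagata {S P : Type} [CommRing S] [IsDomain S] [IsNoetherianRing S] [CommRing P] [IsDomain P]
    [UniqueFactorizationMonoid P] (i : P →+* S) (hi : Function.Injective i) (l : P)
    (hx : Prime (i l)) (H : ∀ h : S, ∃ n p, i l ^ n * h = i p) : UniqueFactorizationMonoid S := by
  rw [UniqueFactorizationMonoid.iff_exists_prime_mem_of_isPrime]
  intro I hI hI'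
  by_cases hxI : i l ∈ I
  · exact ⟨_, hxI, hx⟩
  obtain ⟨h, hh, hh0⟩ := Submodule.exists_mem_ne_zero_of_ne_bot hI
  obtain ⟨n, p, hp⟩ := H h
  have hne : I.comap i ≠ ⊥ := by
    intro hb
    have : p ∈ I.comap i := by rw [Ideal.mem_comap, ← hp]; exact I.mul_mem_left _ hh
    rw [hb, Ideal.mem_bot] at this
    rw [this, map_zero] at hp
    exact mul_ne_zero (pow_ne_zero _ hx.ne_zero) hh0 hp
  obtain ⟨π, hπI, hπ⟩ := UniqueFactorizationMonoid.iff_exists_prime_mem_of_isPrime.1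
    (inferInstance : UniqueFactorizationMonoid P) (I.comap i) hne (Ideal.comap_isPrime i I)
  have hiπ : i π ∈ I := hπI
  have hiπ0 : i π ≠ 0 := (map_ne_zero_iff i hi).2 hπ.ne_zero
  obtain ⟨j, π', hπ', hj⟩ : ∃ j π', i π = i l ^ j * π' ∧ ¬ i l ∣ π' := by
    obtain ⟨c, h1, h2⟩ := (FiniteMultiplicity.of_not_isUnit hx.not_isUnit hiπ0).exists_eq_pow_mul_and_not_dvd
    exact ⟨_, c, h1, h2⟩
  have hπ'I : π' ∈ I := by
    rw [hπ'] at hiπ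
    exact (hI'.mem_or_mem hiπ).resolve_left (fun h => hxI (hI'.mem_of_pow_mem _ h))
  have hπ'0 : π' ≠ 0 := by rintro rfl; simp at hj
  have key : ∀ n u u', i l ^ n * u = i u' → π ∣ u' → π' ∣ u := by
    intro n u u' h1 ⟨c, hc⟩
    have h2 : π' * (i l ^ j * i c) = i l ^ n * u := by
      rw [h1, hc, map_mul, hπ']; ring
    have h3 : i l ^ n ∣ i l ^ j * i c :=
      hx.pow_dvd_of_dvd_mul_left n hj ⟨u, h2⟩
    obtain ⟨d, hd⟩ := h3
    refine ⟨d, mul_left_cancel₀ (pow_ne_zero n hx.ne_zero) ?_⟩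
    rw [← h2, hd]; ring
  refine ⟨π', hπ'I, hπ'0, fun hu => hI'.ne_top (Ideal.eq_top_of_isUnit_mem _ hπ'I hu), ?_⟩
  rintro u v ⟨w, hw⟩
  obtain ⟨n1, u', hu'⟩ := H u
  obtain ⟨n2, v', hv'⟩ := H v
  obtain ⟨n3, w', hw'⟩ := H w
  have e1 : π * (w' * l ^ (n1 + n2)) = l ^ (j + n3) * (u' * v') := by
    apply hi
    simp only [map_mul, map_pow]
    rw [← hu', ← hv', ← hw', hπ']
    linear_combination (-(i l) ^ (j + n3 + n1 + n2)) * hw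
  have e2 : π ∣ l ^ (j + n3) * (u' * v') := ⟨_, e1.symm⟩
  rcases hπ.dvd_or_dvd e2 with h | h
  · exfalso
    obtain ⟨c, hc⟩ := hπ.dvd_of_dvd_pow h
    have h5 : i l = i π * i c := by rw [hc, map_mul]
    rcases hx.irreducible.isUnit_or_isUnit h5 with h6 | h6
    · exact hI'.ne_top (Ideal.eq_top_of_isUnit_mem _ hiπ h6)
    · apply hxI; rw [h5]; exact I.mul_mem_right _ hiπ
  · rcases hπ.dvd_or_dvd h with h | h
    · left; exact key _ _ _ hu' h
    · right; exact key _ _ _ hv' h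

variable {P : Type} [CommRing P] [IsDomain P]

open Polynomial in
lemma elim_X (l r : P) (h : P[X]) : ∃ (n : ℕ) (p : P) (u : P[X]),
    Polynomial.C l ^ n * h = Polynomial.C p + (Polynomial.C l * Polynomial.X + Polynomial.C r) * u := by
  induction h using Polynomial.induction_on' with
  | add f g hf hg =>
    obtain ⟨n, p, u, h1⟩ := hf
    obtain ⟨n', p', u', h2⟩ := hg
    refine ⟨n + n', l ^ n' * p + l ^ n * p', Polynomial.C l ^ n' * u + Polynomial.C l ^ n * u', ?_⟩
    simp only [map_add, map_mul, map_pow]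
    linear_combination Polynomial.C l ^ n' * h1 + Polynomial.C l ^ n * h2
  | monomial n c =>
    have := sub_dvd_pow_sub_pow (Polynomial.C l * Polynomial.X : P[X]) (-Polynomial.C r) n
    obtain ⟨u, hu⟩ := this
    refine ⟨n, (-r) ^ n * c, Polynomial.C c * u, ?_⟩
    rw [← Polynomial.C_mul_X_pow_eq_monomial]
    simp only [map_mul, map_pow, map_neg]
    linear_combination Polynomial.C c * hu

open Polynomial in
lemma C_mem_span (l r p : P) (hl : l ≠ 0)
    (h : Polynomial.C p ∈ Ideal.span {(Polynomial.C l * Polynomial.X + Polynomial.C r : P[X])}) :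
    p = 0 := by
  obtain ⟨u, hu⟩ := mem_sp1.1 h
  by_cases hu0 : u = 0
  · rw [hu0, mul_zero] at hu; simpa using hu
  · have h1 := congrArg Polynomial.natDegree hu
    have h2 : (Polynomial.C l * Polynomial.X + Polynomial.C r : P[X]) ≠ 0 := by
      intro h0
      have := Polynomial.natDegree_linear (b := r) hl
      rw [h0] at this; simp at this
    rw [Polynomial.natDegree_mul h2 hu0, Polynomial.natDegree_linear hl, Polynomial.natDegree_C] at h1
    omega

open Polynomial in
lemma ufdi_nagata [UniqueFactorizationMonoid P] [IsNoetherianRing P] (l r : P) (hl : l ≠ 0)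
    (ha : Prime (Polynomial.C l * Polynomial.X + Polynomial.C r : P[X]))
    (hlr : (Ideal.span {l} ⊔ Ideal.span {r}).IsPrime) :
    UFDI (Ideal.span {(Polynomial.C l * Polynomial.X + Polynomial.C r : P[X])}) := by
  set a : P[X] := Polynomial.C l * Polynomial.X + Polynomial.C r with hadef
  have hp : (Ideal.span {a}).IsPrime := (Ideal.span_singleton_prime ha.ne_zero).2 ha
  refine ⟨hp, ?_⟩
  let i : P →+* P[X] ⧸ Ideal.span {a} := (Ideal.Quotient.mk _).comp Polynomial.C
  have hi : Function.Injective i := by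
    rw [injective_iff_map_eq_zero]
    intro p hp
    exact C_mem_span l r p hl (Ideal.Quotient.eq_zero_iff_mem.1 hp)
  refine nagata i hi l ?_ ?_
  · have hne : i l ≠ 0 := (map_ne_zero_iff i hi).2 hl
    rw [← Ideal.span_singleton_prime hne]
    have h1 : (Ideal.span {a} ⊔ Ideal.span {Polynomial.C l}) =
        (Ideal.span {l} ⊔ Ideal.span {r}).map (Polynomial.C : P →+* P[X]) := by
      rw [Ideal.map_sup, Ideal.map_span, Ideal.map_span, Set.image_singleton, Set.image_singleton]
      apply le_antisymm
      · refine sup_le ?_ le_sup_left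
        rw [Ideal.span_singleton_le_iff_mem, mem_two]
        exact ⟨Polynomial.X, 1, by rw [hadef]; ring⟩
      · refine sup_le le_sup_right ?_
        rw [Ideal.span_singleton_le_iff_mem, mem_two]
        exact ⟨1, -Polynomial.X, by rw [hadef]; ring⟩
    have h2 : (Ideal.span {a} ⊔ Ideal.span {Polynomial.C l}).IsPrime := by
      rw [h1]; have := hlr; exact Ideal.isPrime_map_C_of_isPrime
    have h3 : Ideal.span {i l} = (Ideal.span {a} ⊔ Ideal.span {Polynomial.C l}).map
        (Ideal.Quotient.mk (Ideal.span {a})) := by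
      rw [Ideal.map_sup, Ideal.map_quotient_self, bot_sup_eq, Ideal.map_span, Set.image_singleton]
      rfl
    rw [h3]
    apply Ideal.map_isPrime_of_surjective Ideal.Quotient.mk_surjective
    rw [Ideal.mk_ker]; exact le_sup_left
  · intro h
    obtain ⟨h, rfl⟩ := Ideal.Quotient.mk_surjective h
    obtain ⟨n, p, u, hu⟩ := elim_X l r h
    refine ⟨n, p, ?_⟩
    change (Ideal.Quotient.mk _ (Polynomial.C l)) ^ n * _ = Ideal.Quotient.mk _ (Polynomial.C p)
    rw [← map_pow, ← map_mul, Ideal.Quotient.eq, hu]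
    exact mem_sp1.2 ⟨u, by ring⟩

end Nag

section SES
variable {R B : Type} [CommRing R] [CommRing B] [Algebra R B]

lemma ses_equiv (M1 M2 : Submodule R B) (c : B) (hc : ∀ x, c * x = 0 → x = 0)
    (h12 : ∀ m ∈ M1, c * m ∈ M2) (u : B) (hu : u ∈ M2) (J : Ideal R)
    (hJ : ∀ r, r ∈ J ↔ ∃ m ∈ M1, r • u = c * m)
    (hs : ∀ m ∈ M2, ∃ r : R, ∃ m1 ∈ M1, m = r • u + c * m1) :
    ∃ f : M1 →ₗ[R] M2, Function.Injective f ∧ Nonempty ((R ⧸ J) ≃ₗ[R] (M2 ⧸ LinearMap.range f)) := by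
  let f : M1 →ₗ[R] M2 := (LinearMap.mulLeft R c).restrict h12
  have hf : ∀ m : M1, ((f m : M2) : B) = c * m := fun m => rfl
  refine ⟨f, ?_, ?_⟩
  · rw [← LinearMap.ker_eq_bot, LinearMap.ker_eq_bot']
    intro m hm
    have := congrArg (Subtype.val) hm
    rw [hf] at this
    exact Subtype.ext (hc _ this)
  · let q : R →ₗ[R] (M2 ⧸ LinearMap.range f) :=
      (LinearMap.range f).mkQ.comp (LinearMap.toSpanSingleton R M2 ⟨u, hu⟩)
    have hq : Function.Surjective q := by
      intro m
      obtain ⟨m, rfl⟩ := Submodule.mkQ_surjective _ m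
      obtain ⟨r, m1, hm1, h⟩ := hs m.1 m.2
      refine ⟨r, ?_⟩
      simp only [q, LinearMap.comp_apply, LinearMap.toSpanSingleton_apply, Submodule.mkQ_apply]
      rw [Submodule.Quotient.eq]
      refine ⟨-⟨m1, hm1⟩, ?_⟩
      apply Subtype.ext
      rw [map_neg]
      change -(c * m1) = r • u - m.1
      rw [h]; ring
    have hk : LinearMap.ker q = J := by
      ext r
      rw [hJ, LinearMap.mem_ker]
      simp only [q, LinearMap.comp_apply, LinearMap.toSpanSingleton_apply, Submodule.mkQ_apply]
      rw [Submodule.Quotient.mk_eq_zero]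
      constructor
      · rintro ⟨m, hm⟩
        exact ⟨m.1, m.2, (congrArg Subtype.val hm).symm⟩
      · rintro ⟨m, hm, h⟩
        exact ⟨⟨m, hm⟩, Subtype.ext h.symm⟩
    subst hk
    exact ⟨q.quotKerEquivOfSurjective hq⟩

lemma ses_mid (M1 M2 : Submodule R B) (c : B) (hc : ∀ x, c * x = 0 → x = 0)
    (h12 : ∀ m ∈ M1, c * m ∈ M2) (u : B) (hu : u ∈ M2) (J : Ideal R)
    (hJ : ∀ r, r ∈ J ↔ ∃ m ∈ M1, r • u = c * m)
    (hs : ∀ m ∈ M2, ∃ r : R, ∃ m1 ∈ M1, m = r • u + c * m1) {n : ℕ}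
    (h1 : PDL R M1 n) (h3 : PDI J n) : PDL R M2 n := by
  obtain ⟨f, hf, ⟨e⟩⟩ := ses_equiv M1 M2 c hc h12 u hu J hJ hs
  exact pdl_mid f (LinearMap.range f).mkQ (LinearMap.exact_map_mkQ_range f) hf
    (Submodule.mkQ_surjective _) h1 (PDL.of_equiv e h3)

lemma ses_right (M1 M2 : Submodule R B) (c : B) (hc : ∀ x, c * x = 0 → x = 0)
    (h12 : ∀ m ∈ M1, c * m ∈ M2) (u : B) (hu : u ∈ M2) (J : Ideal R)
    (hJ : ∀ r, r ∈ J ↔ ∃ m ∈ M1, r • u = c * m)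
    (hs : ∀ m ∈ M2, ∃ r : R, ∃ m1 ∈ M1, m = r • u + c * m1) {n : ℕ}
    (h1 : PDL R M1 n) (h2 : PDL R M2 (n + 1)) : PDI J (n + 1) := by
  obtain ⟨f, hf, ⟨e⟩⟩ := ses_equiv M1 M2 c hc h12 u hu J hJ hs
  exact PDL.of_equiv e.symm (pdl_right f (LinearMap.range f).mkQ (LinearMap.exact_map_mkQ_range f) hf
    (Submodule.mkQ_surjective _) h1 h2)

end SES

section Cox
variable {R A σ : Type} [CommRing R] [CommRing A] [Algebra R (MvPolynomial σ A)]

/-- weighted piece as a module over a ring mapping into degree zero -/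
def WM (w : σ → ℤ) (h0 : ∀ r : R, IsWeightedHomogeneous w (algebraMap R (MvPolynomial σ A) r) 0)
    (n : ℤ) : Submodule R (MvPolynomial σ A) where
  carrier := {f | IsWeightedHomogeneous w f n}
  add_mem' := fun ha hb => ha.add hb
  zero_mem' := isWeightedHomogeneous_zero _ _ _
  smul_mem' := by
    intro r f hf
    rw [Algebra.smul_def]
    have := (h0 r).mul hf
    rwa [zero_add] at this

lemma mem_WM {w : σ → ℤ} {h0 : ∀ r : R, IsWeightedHomogeneous w (algebraMap R (MvPolynomial σ A) r) 0}
    {n : ℤ} {f : MvPolynomial σ A} : f ∈ WM w h0 n ↔ IsWeightedHomogeneous w f n := Iff.rfl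

variable {w : σ → ℤ} {h0 : ∀ r : R, IsWeightedHomogeneous w (algebraMap R (MvPolynomial σ A) r) 0}

lemma pdl_WM_zero [IsDomain R] {a : R} (ha : a ≠ 0)
    (hker : ∀ r : R, algebraMap R (MvPolynomial σ A) r = 0 ↔ r ∈ Ideal.span {a})
    (hsurj : ∀ f : MvPolynomial σ A, IsWeightedHomogeneous w f 0 → ∃ r, algebraMap R _ r = f) :
    PDL R (WM w h0 0) 1 := by
  refine ses_mid (⊥ : Submodule R (MvPolynomial σ A)) _ 1 (by simp) ?_ 1 ?_ (Ideal.span {a}) ?_ ?_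
    (PDL.of_projective 1) (pdi_span_singleton a ha)
  · intro m hm
    rw [Submodule.mem_bot] at hm; rw [hm, mul_zero]; exact Submodule.zero_mem _
  · exact isWeightedHomogeneous_one _ _
  · intro r
    rw [← hker, Algebra.smul_def, mul_one]
    simp
  · intro m hm
    obtain ⟨r, hr⟩ := hsurj m hm
    exact ⟨r, 0, Submodule.zero_mem _, by rw [Algebra.smul_def, hr]; simp⟩

lemma cofactor_wh [IsDomain A] {f g : MvPolynomial σ A} {n m : ℤ} (hf0 : f ≠ 0)
    (hf : IsWeightedHomogeneous w f n) (h : IsWeightedHomogeneous w (f * g) m) :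
    IsWeightedHomogeneous w g (m - n) := by
  by_cases hg : g = 0
  · rw [hg]; exact isWeightedHomogeneous_zero _ _ _
  · have hne := mul_ne_zero hf0 hg
    obtain ⟨j, hj⟩ := wh_factor (w := w) (f := g) (g := f) (m := m) (by rwa [mul_comm]) (by rwa [mul_comm])
    have := (hf.mul hj).inj_right hne h
    have e : m - n = j := by rw [← this]; ring
    rwa [e]

lemma cox_good [IsDomain R] [IsDomain A] [UniqueFactorizationMonoid (MvPolynomial σ A)] {a : R} (ha : a ≠ 0)
    (hker : ∀ r : R, algebraMap R (MvPolynomial σ A) r = 0 ↔ r ∈ Ideal.span {a})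
    (hsurj : ∀ f : MvPolynomial σ A, IsWeightedHomogeneous w f 0 → ∃ r, algebraMap R _ r = f)
    (hpd : ∀ n (β φ : MvPolynomial σ A), β ≠ 0 → IsRelPrime β φ → IsWeightedHomogeneous w β n →
      IsWeightedHomogeneous w φ n → PDL R (WM w h0 (-n)) 2) : Good a := by
  intro b f hb J hJ
  set Ψ := algebraMap R (MvPolynomial σ A) with hΨ
  have hb0 : Ψ b ≠ 0 := by rwa [Ne, hker]
  obtain ⟨β, φ, e, h1, h2, h3, h4, h5⟩ := ufd_reduce (Ψ b) (Ψ f) hb0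
  obtain ⟨n, hn⟩ := wh_factor (w := w) (f := β) (g := e) (m := 0) (by rwa [← h1]) (by rw [← h1]; exact h0 b)
  have he : IsWeightedHomogeneous w e (0 - n) := cofactor_wh h3 hn (by rw [← h1]; exact h0 b)
  have hφ : IsWeightedHomogeneous w φ n := by
    have := cofactor_wh (m := 0) h4 he (g := φ) (by rw [mul_comm, ← h2]; exact h0 f)
    simpa using this
  refine ses_right (WM w h0 (-n)) (WM w h0 0) β ?_ ?_ 1 (isWeightedHomogeneous_one _ _) J ?_ ?_
    (hpd n β φ h3 h5 hn hφ) ((pdl_WM_zero ha hker hsurj).mono (by omega))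
  · intro x hx; exact (mul_eq_zero.1 hx).resolve_left h3
  · intro m hm
    have := hn.mul hm
    rw [add_neg_cancel] at this
    exact this
  · intro r
    rw [Algebra.smul_def, mul_one, ← hΨ, hJ, mem_sup_span]
    constructor
    · rintro ⟨t, ht⟩
      rw [← hker, map_sub, map_mul, map_mul, h1, h2] at ht
      have h6 : β * Ψ t = φ * Ψ r := by
        apply mul_left_cancel₀ h4
        linear_combination -ht
      obtain ⟨m, hm1, hm2⟩ := relprime_syz h3 h5 h6
      refine ⟨m, ?_, hm2⟩
      have := cofactor_wh h3 hn (g := m) (m := 0) (by rw [← hm2]; exact h0 r)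
      rw [zero_sub] at this
      exact this
    · rintro ⟨m, hm, h⟩
      have h7 : IsWeightedHomogeneous w (φ * m) 0 := by
        have := hφ.mul hm
        rw [add_neg_cancel] at this
        exact this
      obtain ⟨t, ht⟩ := hsurj _ h7
      refine ⟨t, ?_⟩
      rw [← hker, map_sub, map_mul, map_mul, h1, h2, h, ht]
      ring
  · intro m hm
    obtain ⟨r, hr⟩ := hsurj m hm
    exact ⟨r, 0, Submodule.zero_mem _, by rw [Algebra.smul_def, hr]; simp⟩

lemma wh_induct {n : ℤ} {p : MvPolynomial σ A → Prop} (h0 : p 0) (hadd : ∀ f g, p f → p g → p (f + g))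
    (hmon : ∀ d c, Finsupp.weight w d = n → p (monomial d c)) (f : MvPolynomial σ A)
    (hf : IsWeightedHomogeneous w f n) : p f := by
  rw [← support_sum_monomial_coeff f]
  refine Finset.sum_induction _ p hadd h0 ?_
  intro d hd
  exact hmon d _ (hf (mem_support_iff.1 hd))

end Cox

section Psi
variable {A σ τ : Type} [CommRing A]

lemma ker_of_elim {P B : Type} [CommRing P] [IsDomain P] [CommRing B] (Ψ : Polynomial P →+* B) (l r : P)
    (hl : l ≠ 0) (ha : Prime (Polynomial.C l * Polynomial.X + Polynomial.C r))
    (h0 : Ψ (Polynomial.C l * Polynomial.X + Polynomial.C r) = 0)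
    (hinj : ∀ p, Ψ (Polynomial.C p) = 0 → p = 0) (h : Polynomial P) :
    Ψ h = 0 ↔ h ∈ Ideal.span {Polynomial.C l * Polynomial.X + Polynomial.C r} := by
  constructor
  · intro hh
    obtain ⟨n, p, u, hu⟩ := elim_X l r h
    have h1 := congrArg Ψ hu
    rw [map_mul, hh, mul_zero, map_add, map_mul, h0, zero_mul, add_zero] at h1
    have hp := hinj p h1.symm
    rw [hp, map_zero, zero_add] at hu
    have h2 : (Polynomial.C l * Polynomial.X + Polynomial.C r) ∣ Polynomial.C l ^ n * h := ⟨u, hu⟩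
    rcases ha.dvd_or_dvd h2 with h3 | h3
    · exact absurd (C_mem_span l r l hl (Ideal.mem_span_singleton.2 (ha.dvd_of_dvd_pow h3))) hl
    · exact Ideal.mem_span_singleton.2 h3
  · intro hh
    obtain ⟨u, rfl⟩ := mem_sp1.1 hh
    rw [map_mul, h0, zero_mul]

/-- evaluation map from a polynomial ring over a polynomial ring -/
def psi {B : Type} [CommRing B] [Algebra A B] (v : τ → B) (y : B) :
    Polynomial (MvPolynomial τ A) →+* B :=
  Polynomial.eval₂RingHom (aeval v : MvPolynomial τ A →ₐ[A] B).toRingHom y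

variable {B : Type} [CommRing B] [Algebra A B] (v : τ → B) (y : B)

lemma psi_X : psi (A := A) v y Polynomial.X = y := by simp [psi]

lemma psi_C (p : MvPolynomial τ A) : psi (A := A) v y (Polynomial.C p) = aeval v p := by simp [psi]

lemma psi_CX (i : τ) : psi (A := A) v y (Polynomial.C (X i)) = v i := by simp [psi]

lemma psi_CC (c : A) : psi (A := A) v y (Polynomial.C (C c)) = algebraMap A B c := by simp [psi]

lemma psi_wh (w : σ → ℤ) (v : τ → MvPolynomial σ A) (y : MvPolynomial σ A)
    (hv : ∀ i, IsWeightedHomogeneous w (v i) 0) (hy : IsWeightedHomogeneous w y 0)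
    (r : Polynomial (MvPolynomial τ A)) : IsWeightedHomogeneous w (psi v y r) 0 := by
  have hP : ∀ p : MvPolynomial τ A, IsWeightedHomogeneous w (aeval v p) 0 := by
    intro p
    induction p using MvPolynomial.induction_on with
    | C a => rw [algHom_C, algebraMap_eq]; exact isWeightedHomogeneous_C w a
    | add p q hp hq => rw [map_add]; exact hp.add hq
    | mul_X p i hp =>
      rw [map_mul, aeval_X]
      have := hp.mul (hv i)
      rwa [add_zero] at this
  induction r using Polynomial.induction_on' with
  | add p q hp hq => rw [map_add]; exact hp.add hq
  | monomial n c =>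
    rw [← Polynomial.C_mul_X_pow_eq_monomial, map_mul, map_pow, psi_C, psi_X]
    have := (hP c).mul (hy.pow n)
    simpa using this

/-- an `A`-algebra retraction argument: if `ρ ∘ Ψ` kills exactly the listed variables. -/
lemma psi_comp_eq {B' : Type} [CommRing B'] [Algebra A B'] (ρ : B →ₐ[A] B') (r : Polynomial (MvPolynomial τ A)) :
    ρ (psi v y r) = psi (fun i => ρ (v i)) (ρ y) r := by
  have : (ρ : B →+* B').comp (psi (A := A) v y) = psi (A := A) (fun i => ρ (v i)) (ρ y) := by
    apply Polynomial.ringHom_ext'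
    · apply MvPolynomial.ringHom_ext
      · intro c; simp [psi]
      · intro i; simp [psi]
    · simp [psi]
  exact congrArg (fun f => f r) this

/-- congruence modulo an ideal of an endomorphism which is the identity on generators modulo it -/
lemma psi_sub_mem (I : Ideal (Polynomial (MvPolynomial τ A))) (v : τ → Polynomial (MvPolynomial τ A))
    (y : Polynomial (MvPolynomial τ A)) (hv : ∀ i, Polynomial.C (X i) - v i ∈ I)
    (hy : Polynomial.X - y ∈ I) (r : Polynomial (MvPolynomial τ A)) : r - psi (A := A) v y r ∈ I := by
  have : (Ideal.Quotient.mk I) = (Ideal.Quotient.mk I).comp (psi (A := A) v y) := by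
    apply Polynomial.ringHom_ext'
    · apply MvPolynomial.ringHom_ext
      · intro c; simp [psi]
      · intro i
        simpa [psi] using Ideal.Quotient.eq.2 (hv i)
    · simpa [psi] using Ideal.Quotient.eq.2 hy
  rw [← Ideal.Quotient.eq]
  exact congrArg (fun f => f r) this

lemma pdi_two_vars [IsDomain A] (i j : τ) (hij : i ≠ j) :
    PDI (Ideal.span {(Polynomial.C (X i) : Polynomial (MvPolynomial τ A))} ⊔
      Ideal.span {Polynomial.C (X j)}) 2 := by
  have hp : Prime (Polynomial.C (X i) : Polynomial (MvPolynomial τ A)) :=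
    Polynomial.prime_C_iff.2 (X_prime)
  refine pdi_prime_sup ((Ideal.span_singleton_prime hp.ne_zero).2 hp) ?_
    (pdi_span_singleton _ hp.ne_zero)
  rw [Ideal.mem_span_singleton, Polynomial.C_dvd_iff_dvd_coeff]
  intro h
  have := h 0
  rw [Polynomial.coeff_C_zero, X_dvd_X] at this
  exact hij this

end Psi

section R4
variable {A : Type} [CommRing A]

def w4 : Fin 4 → ℤ := ![1, 1, -1, -1]

lemma mono4 {n : ℤ} {p : MvPolynomial (Fin 4) A → Prop} (h0 : p 0) (hadd : ∀ f g, p f → p g → p (f + g))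
    (hmon : ∀ (c : A) (i j s t : ℕ), (i : ℤ) + j - s - t = n →
      p (C c * X 0 ^ i * X 1 ^ j * X 2 ^ s * X 3 ^ t)) (f : MvPolynomial (Fin 4) A)
    (hf : IsWeightedHomogeneous w4 f n) : p f := by
  refine wh_induct h0 hadd ?_ f hf
  intro d c hd
  rw [Finsupp.weight_apply, Finsupp.sum_fintype _ _ (by simp)] at hd
  simp only [Fin.sum_univ_four, w4] at hd
  rw [monomial_eq, Finsupp.prod_fintype _ _ (by simp), Fin.prod_univ_four]
  have := hmon c (d 0) (d 1) (d 2) (d 3) (by rw [← hd]; simp; ring)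
  convert this using 1
  ring

variable (A) in
def v4 : Fin 3 → MvPolynomial (Fin 4) A := ![X 0 * X 2, X 0 * X 3, X 1 * X 2]

variable (A) in
def psi4 : Polynomial (MvPolynomial (Fin 3) A) →+* MvPolynomial (Fin 4) A :=
  psi (A := A) (v4 A) (X 1 * X 3)

lemma wX4 (i : Fin 4) : IsWeightedHomogeneous w4 (X i : MvPolynomial (Fin 4) A) (w4 i) :=
  isWeightedHomogeneous_X _ _ _

lemma psi4_wh (r : Polynomial (MvPolynomial (Fin 3) A)) : IsWeightedHomogeneous w4 (psi4 A r) 0 := by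
  apply psi_wh
  · intro i
    fin_cases i
    · exact (wX4 0).mul (wX4 2)
    · exact (wX4 0).mul (wX4 3)
    · exact (wX4 1).mul (wX4 2)
  · exact (wX4 1).mul (wX4 3)

lemma psi4_x : psi4 A (Polynomial.C (X 0)) = X 0 * X 2 := by rw [psi4, psi_CX]; rfl
lemma psi4_z : psi4 A (Polynomial.C (X 1)) = X 0 * X 3 := by rw [psi4, psi_CX]; rfl
lemma psi4_w : psi4 A (Polynomial.C (X 2)) = X 1 * X 2 := by rw [psi4, psi_CX]; rfl
lemma psi4_y : psi4 A Polynomial.X = X 1 * X 3 := by rw [psi4, psi_X]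
lemma psi4_c (c : A) : psi4 A (Polynomial.C (C c)) = C c := by rw [psi4, psi_CC]; rfl

lemma psi4_surj (f : MvPolynomial (Fin 4) A) (hf : IsWeightedHomogeneous w4 f 0) :
    ∃ r, psi4 A r = f := by
  refine mono4 (p := fun f => ∃ r, psi4 A r = f) ⟨0, map_zero _⟩ ?_ ?_ f hf
  · rintro _ _ ⟨r, rfl⟩ ⟨s, rfl⟩; exact ⟨r + s, map_add _ _ _⟩
  · intro c i j s t h
    rcases le_total i s with hle | hle
    · obtain ⟨d, rfl⟩ := Nat.exists_eq_add_of_le hle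
      obtain rfl : j = d + t := by omega
      refine ⟨Polynomial.C (C c) * Polynomial.C (X 0) ^ i * Polynomial.C (X 2) ^ d * Polynomial.X ^ t, ?_⟩
      simp only [map_mul, map_pow, psi4_x, psi4_w, psi4_y, psi4_c]
      ring
    · obtain ⟨d, rfl⟩ := Nat.exists_eq_add_of_le hle
      obtain rfl : t = d + j := by omega
      refine ⟨Polynomial.C (C c) * Polynomial.C (X 0) ^ s * Polynomial.C (X 1) ^ d * Polynomial.X ^ j, ?_⟩
      simp only [map_mul, map_pow, psi4_x, psi4_z, psi4_y, psi4_c]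
      ring

lemma psi4_inj [IsDomain A] (p : MvPolynomial (Fin 3) A) (h : psi4 A (Polynomial.C p) = 0) : p = 0 := by
  let K := FractionRing (MvPolynomial (Fin 3) A)
  let q : MvPolynomial (Fin 3) A →ₐ[A] K := IsScalarTower.toAlgHom A _ K
  have hq : Function.Injective q := IsFractionRing.injective (MvPolynomial (Fin 3) A) K
  have hx : q (X 0) ≠ 0 := (map_ne_zero_iff q hq).2 (X_ne_zero 0)
  let ρ : MvPolynomial (Fin 4) A →ₐ[A] K := aeval ![1, q (X 2) / q (X 0), q (X 0), q (X 1)]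
  have h1 : ρ (psi4 A (Polynomial.C p)) = q p := by
    rw [psi4, psi_C]
    have : ρ.comp (aeval (v4 A)) = q := by
      ext i
      fin_cases i
      · simp [ρ, v4]
      · simp [ρ, v4]
      · simp only [ρ, v4, AlgHom.comp_apply, aeval_X]
        simpa using div_mul_cancel₀ (q (X 2)) hx
    exact congrArg (fun f => f p) this
  rw [h, map_zero] at h1
  exact (map_eq_zero_iff q hq).1 h1.symm

lemma psi4_s (r : Polynomial (MvPolynomial (Fin 3) A)) (m : MvPolynomial (Fin 4) A) (n : ℕ)
    (h : psi4 A r * X 1 ^ n = X 0 * m) :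
    r ∈ Ideal.span {(Polynomial.C (X 0) : Polynomial (MvPolynomial (Fin 3) A))} ⊔
      Ideal.span {Polynomial.C (X 1)} := by
  let ρ : MvPolynomial (Fin 4) A →ₐ[A] Polynomial (MvPolynomial (Fin 3) A) :=
    aeval ![0, 1, Polynomial.C (X 2), Polynomial.X]
  have h1 := congrArg ρ h
  have e0 : ρ (X 0) = 0 := by simp [ρ]
  have e1 : ρ (X 1) = 1 := by simp [ρ]
  have e2 : ρ (X 2) = Polynomial.C (X 2) := by simp [ρ]
  have e3 : ρ (X 3) = Polynomial.X := by simp [ρ]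
  rw [map_mul, map_mul, map_pow, e0, e1, one_pow, mul_one, zero_mul, psi4, psi_comp_eq] at h1
  rw [← sub_zero r, ← h1]
  apply psi_sub_mem
  · intro i
    fin_cases i
    · simp only [v4, Fin.zero_eta, Matrix.cons_val_zero, map_mul, e0, zero_mul, sub_zero]
      exact Ideal.mem_sup_left (Ideal.mem_span_singleton_self _)
    · simp only [v4, Fin.mk_one, Matrix.cons_val_one, Matrix.cons_val_zero, map_mul, e0, zero_mul, sub_zero]
      exact Ideal.mem_sup_right (Ideal.mem_span_singleton_self _)
    · simp [v4, e1, e2]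
  · simp [e1, e3]

lemma psi4_t (r : Polynomial (MvPolynomial (Fin 3) A)) (m : MvPolynomial (Fin 4) A) (n : ℕ)
    (h : psi4 A r * X 3 ^ n = X 2 * m) :
    r ∈ Ideal.span {(Polynomial.C (X 0) : Polynomial (MvPolynomial (Fin 3) A))} ⊔
      Ideal.span {Polynomial.C (X 2)} := by
  let ρ : MvPolynomial (Fin 4) A →ₐ[A] Polynomial (MvPolynomial (Fin 3) A) :=
    aeval ![Polynomial.C (X 1), Polynomial.X, 0, 1]
  have h1 := congrArg ρ h
  have e0 : ρ (X 2) = 0 := by simp [ρ]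
  have e1 : ρ (X 3) = 1 := by simp [ρ]
  have e2 : ρ (X 0) = Polynomial.C (X 1) := by simp [ρ]
  have e3 : ρ (X 1) = Polynomial.X := by simp [ρ]
  rw [map_mul, map_mul, map_pow, e0, e1, one_pow, mul_one, zero_mul, psi4, psi_comp_eq] at h1
  rw [← sub_zero r, ← h1]
  apply psi_sub_mem
  · intro i
    fin_cases i
    · simp only [v4, Fin.zero_eta, Matrix.cons_val_zero, map_mul, e0, mul_zero, sub_zero]
      exact Ideal.mem_sup_left (Ideal.mem_span_singleton_self _)
    · simp [v4, e1, e2]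
    · have : (v4 A ⟨2, by omega⟩) = X 1 * X 2 := rfl
      simp only [this, map_mul, e0, mul_zero, sub_zero]
      exact Ideal.mem_sup_right (Ideal.mem_span_singleton_self _)
  · simp [e1, e3]

lemma good4 [IsDomain A] [UniqueFactorizationMonoid A] 
    (ha : Prime (Polynomial.C (X 0) * Polynomial.X + Polynomial.C (-(X 1 * X 2)) :
      Polynomial (MvPolynomial (Fin 3) A))) :
    Good (Polynomial.C (X 0) * Polynomial.X + Polynomial.C (-(X 1 * X 2)) :
      Polynomial (MvPolynomial (Fin 3) A)) := by
  let _ : Algebra (Polynomial (MvPolynomial (Fin 3) A)) (MvPolynomial (Fin 4) A) := (psi4 A).toAlgebra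
  have hal : ∀ r, algebraMap (Polynomial (MvPolynomial (Fin 3) A)) (MvPolynomial (Fin 4) A) r = psi4 A r :=
    fun r => rfl
  have hker : ∀ r, algebraMap (Polynomial (MvPolynomial (Fin 3) A)) (MvPolynomial (Fin 4) A) r = 0 ↔
      r ∈ Ideal.span {(Polynomial.C (X 0) * Polynomial.X + Polynomial.C (-(X 1 * X 2)) :
      Polynomial (MvPolynomial (Fin 3) A))} := by
    refine ker_of_elim (psi4 A) _ _ (X_ne_zero 0) ha ?_ psi4_inj
    simp only [map_add, map_mul, map_neg, psi4_x, psi4_y, psi4_z, psi4_w]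
    ring
  have hsm : ∀ (r : Polynomial (MvPolynomial (Fin 3) A)) (u : MvPolynomial (Fin 4) A), r • u = psi4 A r * u :=
    fun r u => Algebra.smul_def r u
  have h0 : ∀ r : Polynomial (MvPolynomial (Fin 3) A), IsWeightedHomogeneous w4 (algebraMap _ (MvPolynomial (Fin 4) A) r) 0 := psi4_wh
  have hz : PDL (Polynomial (MvPolynomial (Fin 3) A)) (WM w4 h0 0) 2 := (pdl_WM_zero ha.ne_zero hker psi4_surj).mono (by omega)
  have hpos : ∀ m : ℕ, PDL (Polynomial (MvPolynomial (Fin 3) A)) (WM w4 h0 (m : ℤ)) 2 := by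
    intro m
    induction m with
    | zero => exact hz
    | succ m ih =>
      refine ses_mid _ _ (X 0) (fun x hx => (mul_eq_zero.1 hx).resolve_left (X_ne_zero 0)) ?_
        (X 1 ^ (m + 1)) ?_ _ ?_ ?_ ih (pdi_two_vars 0 1 (by decide))
      · intro x hx
        have := (wX4 0).mul hx
        rw [mem_WM]
        convert this using 1
        simp [w4]; ring
      · rw [mem_WM]
        have := (wX4 (A := A) 1).pow (m + 1)
        convert this using 1
        simp [w4]
      · intro r
        rw [hsm]
        constructor
        · intro hr
          obtain ⟨s, t, rfl⟩ := mem_two.1 hr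
          refine ⟨(psi4 A s * X 2 + psi4 A t * X 3) * X 1 ^ (m + 1), ?_, ?_⟩
          · have h2 := (psi4_wh s).mul (wX4 2)
            have h3 := (psi4_wh t).mul (wX4 3)
            have h4 := (h2.add h3).mul ((wX4 1).pow (m + 1))
            rw [mem_WM]
            convert h4 using 1
            simp [w4]
          · rw [map_add, map_mul, map_mul, psi4_x, psi4_z]; ring
        · rintro ⟨x, hx, h⟩
          exact psi4_s r x _ h
      · refine mono4 ?_ ?_ ?_
        · exact ⟨0, 0, Submodule.zero_mem _, by rw [hsm, map_zero]; ring⟩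
        · rintro _ _ ⟨r, x, hx, rfl⟩ ⟨s, y, hy, rfl⟩
          exact ⟨r + s, x + y, Submodule.add_mem _ hx hy, by rw [hsm, hsm, hsm, map_add]; ring⟩
        · intro c i j s t h
          rcases i with _ | i
          · obtain rfl : j = m + 1 + s + t := by push_cast at h; omega
            refine ⟨Polynomial.C (C c) * Polynomial.C (X 2) ^ s * Polynomial.X ^ t, 0, Submodule.zero_mem _, ?_⟩
            rw [hsm]
            simp only [map_mul, map_pow, psi4_w, psi4_y, psi4_c]
            ring
          · refine ⟨0, C c * X 0 ^ i * X 1 ^ j * X 2 ^ s * X 3 ^ t, ?_, ?_⟩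
            · rw [mem_WM]
              have := ((((isWeightedHomogeneous_C w4 c).mul ((wX4 0).pow i)).mul ((wX4 1).pow j)).mul
                ((wX4 2).pow s)).mul ((wX4 3).pow t)
              convert this using 1
              simp [w4]
              push_cast at h
              omega
            · rw [hsm, map_zero]; ring
  have hneg : ∀ m : ℕ, PDL (Polynomial (MvPolynomial (Fin 3) A)) (WM w4 h0 (-(m : ℤ))) 2 := by
    intro m
    induction m with
    | zero => simpa using hz
    | succ m ih =>
      refine ses_mid _ _ (X 2) (fun x hx => (mul_eq_zero.1 hx).resolve_left (X_ne_zero 2)) ?_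
        (X 3 ^ (m + 1)) ?_ _ ?_ ?_ ih (pdi_two_vars 0 2 (by decide))
      · intro x hx
        have := (wX4 2).mul hx
        rw [mem_WM]
        convert this using 1
        simp [w4]
      · rw [mem_WM]
        have := (wX4 (A := A) 3).pow (m + 1)
        convert this using 1
        simp [w4]
      · intro r
        rw [hsm]
        constructor
        · intro hr
          obtain ⟨s, t, rfl⟩ := mem_two.1 hr
          refine ⟨(psi4 A s * X 0 + psi4 A t * X 1) * X 3 ^ (m + 1), ?_, ?_⟩
          · have h2 := (psi4_wh s).mul (wX4 0)
            have h3 := (psi4_wh t).mul (wX4 1)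
            have h4 := (h2.add h3).mul ((wX4 3).pow (m + 1))
            rw [mem_WM]
            convert h4 using 1
            simp [w4]
          · rw [map_add, map_mul, map_mul, psi4_x, psi4_w]; ring
        · rintro ⟨x, hx, h⟩
          exact psi4_t r x _ h
      · refine mono4 ?_ ?_ ?_
        · exact ⟨0, 0, Submodule.zero_mem _, by rw [hsm, map_zero]; ring⟩
        · rintro _ _ ⟨r, x, hx, rfl⟩ ⟨s, y, hy, rfl⟩
          exact ⟨r + s, x + y, Submodule.add_mem _ hx hy, by rw [hsm, hsm, hsm, map_add]; ring⟩
        · intro c i j s t h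
          rcases s with _ | s
          · obtain rfl : t = m + 1 + i + j := by push_cast at h; omega
            refine ⟨Polynomial.C (C c) * Polynomial.C (X 1) ^ i * Polynomial.X ^ j, 0, Submodule.zero_mem _, ?_⟩
            rw [hsm]
            simp only [map_mul, map_pow, psi4_z, psi4_y, psi4_c]
            ring
          · refine ⟨0, C c * X 0 ^ i * X 1 ^ j * X 2 ^ s * X 3 ^ t, ?_, ?_⟩
            · rw [mem_WM]
              have := ((((isWeightedHomogeneous_C w4 c).mul ((wX4 0).pow i)).mul ((wX4 1).pow j)).mul
                ((wX4 2).pow s)).mul ((wX4 3).pow t)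
              convert this using 1
              simp [w4]
              push_cast at h
              omega
            · rw [hsm, map_zero]; ring
  refine cox_good (h0 := h0) ha.ne_zero hker psi4_surj ?_
  intro n _ _ _ _ _ _
  rcases Int.le_total 0 n with h | h
  · obtain ⟨m, rfl⟩ := Int.eq_ofNat_of_zero_le h
    exact hneg m
  · obtain ⟨m, hm⟩ := Int.eq_ofNat_of_zero_le (Int.neg_nonneg.2 h)
    rw [hm]; exact hpos m

end R4

section R3
variable {A : Type} [CommRing A]

def w3 : Fin 3 → ℤ := ![1, 1, -2]

lemma mono3 {n : ℤ} {p : MvPolynomial (Fin 3) A → Prop} (h0 : p 0) (hadd : ∀ f g, p f → p g → p (f + g))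
    (hmon : ∀ (c : A) (i j s : ℕ), (i : ℤ) + j - 2 * s = n →
      p (C c * X 0 ^ i * X 1 ^ j * X 2 ^ s)) (f : MvPolynomial (Fin 3) A)
    (hf : IsWeightedHomogeneous w3 f n) : p f := by
  refine wh_induct h0 hadd ?_ f hf
  intro d c hd
  rw [Finsupp.weight_apply, Finsupp.sum_fintype _ _ (by simp)] at hd
  simp only [Fin.sum_univ_three, w3] at hd
  rw [monomial_eq, Finsupp.prod_fintype _ _ (by simp), Fin.prod_univ_three]
  have := hmon c (d 0) (d 1) (d 2) (by rw [← hd]; simp; ring)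
  convert this using 1
  ring

variable (A) in
def v3 : Fin 2 → MvPolynomial (Fin 3) A := ![X 0 * X 0 * X 2, X 0 * X 1 * X 2]

variable (A) in
def psi3 : Polynomial (MvPolynomial (Fin 2) A) →+* MvPolynomial (Fin 3) A :=
  psi (A := A) (v3 A) (X 1 * X 1 * X 2)

lemma wX3 (i : Fin 3) : IsWeightedHomogeneous w3 (X i : MvPolynomial (Fin 3) A) (w3 i) :=
  isWeightedHomogeneous_X _ _ _

lemma psi3_wh (r : Polynomial (MvPolynomial (Fin 2) A)) : IsWeightedHomogeneous w3 (psi3 A r) 0 := by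
  apply psi_wh
  · intro i
    fin_cases i
    · exact ((wX3 0).mul (wX3 0)).mul (wX3 2)
    · exact ((wX3 0).mul (wX3 1)).mul (wX3 2)
  · exact ((wX3 1).mul (wX3 1)).mul (wX3 2)

lemma psi3_x : psi3 A (Polynomial.C (X 0)) = X 0 * X 0 * X 2 := by rw [psi3, psi_CX]; rfl
lemma psi3_z : psi3 A (Polynomial.C (X 1)) = X 0 * X 1 * X 2 := by rw [psi3, psi_CX]; rfl
lemma psi3_y : psi3 A Polynomial.X = X 1 * X 1 * X 2 := by rw [psi3, psi_X]
lemma psi3_c (c : A) : psi3 A (Polynomial.C (C c)) = C c := by rw [psi3, psi_CC]; rfl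

lemma psi3_surj (f : MvPolynomial (Fin 3) A) (hf : IsWeightedHomogeneous w3 f 0) :
    ∃ r, psi3 A r = f := by
  refine mono3 (p := fun f => ∃ r, psi3 A r = f) ⟨0, map_zero _⟩ ?_ ?_ f hf
  · rintro _ _ ⟨r, rfl⟩ ⟨s, rfl⟩; exact ⟨r + s, map_add _ _ _⟩
  · intro c i j s h
    rcases Nat.even_or_odd' i with ⟨i', rfl | rfl⟩
    · obtain ⟨j', rfl⟩ : ∃ j', j = 2 * j' := ⟨s - i', by omega⟩
      obtain rfl : s = i' + j' := by omega
      refine ⟨Polynomial.C (C c) * Polynomial.C (X 0) ^ i' * Polynomial.X ^ j', ?_⟩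
      simp only [map_mul, map_pow, psi3_x, psi3_y, psi3_c]
      ring
    · obtain ⟨j', rfl⟩ : ∃ j', j = 2 * j' + 1 := ⟨s - i' - 1, by omega⟩
      obtain rfl : s = i' + j' + 1 := by omega
      refine ⟨Polynomial.C (C c) * Polynomial.C (X 0) ^ i' * Polynomial.C (X 1) * Polynomial.X ^ j', ?_⟩
      simp only [map_mul, map_pow, psi3_x, psi3_y, psi3_z, psi3_c]
      ring

lemma psi3_inj [IsDomain A] (p : MvPolynomial (Fin 2) A) (h : psi3 A (Polynomial.C p) = 0) : p = 0 := by
  let K := FractionRing (MvPolynomial (Fin 2) A)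
  let q : MvPolynomial (Fin 2) A →ₐ[A] K := IsScalarTower.toAlgHom A _ K
  have hq : Function.Injective q := IsFractionRing.injective (MvPolynomial (Fin 2) A) K
  have hx : q (X 0) ≠ 0 := (map_ne_zero_iff q hq).2 (X_ne_zero 0)
  let ρ : MvPolynomial (Fin 3) A →ₐ[A] K := aeval ![1, q (X 1) / q (X 0), q (X 0)]
  have h1 : ρ (psi3 A (Polynomial.C p)) = q p := by
    rw [psi3, psi_C]
    have : ρ.comp (aeval (v3 A)) = q := by
      ext i
      fin_cases i
      · simp [ρ, v3]
      · simp only [ρ, v3, AlgHom.comp_apply, aeval_X]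
        simpa using div_mul_cancel₀ (q (X 1)) hx
    exact congrArg (fun f => f p) this
  rw [h, map_zero] at h1
  exact (map_eq_zero_iff q hq).1 h1.symm

lemma psi3_s (r : Polynomial (MvPolynomial (Fin 2) A)) (m : MvPolynomial (Fin 3) A)
    (h : psi3 A r * X 1 = X 0 * m) :
    r ∈ Ideal.span {(Polynomial.C (X 0) : Polynomial (MvPolynomial (Fin 2) A))} ⊔
      Ideal.span {Polynomial.C (X 1)} := by
  let ρ : MvPolynomial (Fin 3) A →ₐ[A] Polynomial (MvPolynomial (Fin 2) A) :=
    aeval ![0, 1, Polynomial.X]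
  have h1 := congrArg ρ h
  have e0 : ρ (X 0) = 0 := by simp [ρ]
  have e1 : ρ (X 1) = 1 := by simp [ρ]
  have e2 : ρ (X 2) = Polynomial.X := by simp [ρ]
  rw [map_mul, map_mul, e0, e1, mul_one, zero_mul, psi3, psi_comp_eq] at h1
  rw [← sub_zero r, ← h1]
  apply psi_sub_mem
  · intro i
    fin_cases i
    · simp only [v3, Fin.zero_eta, Matrix.cons_val_zero, map_mul, e0, zero_mul, sub_zero]
      exact Ideal.mem_sup_left (Ideal.mem_span_singleton_self _)
    · simp only [v3, Fin.mk_one, Matrix.cons_val_one, Matrix.cons_val_zero, map_mul, e0, zero_mul, sub_zero]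
      exact Ideal.mem_sup_right (Ideal.mem_span_singleton_self _)
  · simp [e1, e2]

lemma neg_v_dvd {n : ℤ} (hn : n < 0) (f : MvPolynomial (Fin 3) A) (hf : IsWeightedHomogeneous w3 f n) :
    ∃ m, IsWeightedHomogeneous w3 m (n + 2) ∧ f = X 2 * m := by
  refine mono3 (p := fun f => ∃ m, IsWeightedHomogeneous w3 m (n + 2) ∧ f = X 2 * m) ?_ ?_ ?_ f hf
  · exact ⟨0, isWeightedHomogeneous_zero _ _ _, by simp⟩
  · rintro _ _ ⟨m, hm, rfl⟩ ⟨m', hm', rfl⟩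
    exact ⟨m + m', hm.add hm', by ring⟩
  · intro c i j s h
    rcases s with _ | s
    · push_cast at h; omega
    · refine ⟨C c * X 0 ^ i * X 1 ^ j * X 2 ^ s, ?_, by ring⟩
      have := (((isWeightedHomogeneous_C w3 c).mul ((wX3 0).pow i)).mul ((wX3 1).pow j)).mul
                ((wX3 2).pow s)
      convert this using 1
      simp [w3]
      push_cast at h
      omega

lemma good3 [IsDomain A] [UniqueFactorizationMonoid A]
    (ha : Prime (Polynomial.C (X 0) * Polynomial.X + Polynomial.C (-(X 1 * X 1)) :
      Polynomial (MvPolynomial (Fin 2) A))) :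
    Good (Polynomial.C (X 0) * Polynomial.X + Polynomial.C (-(X 1 * X 1)) :
      Polynomial (MvPolynomial (Fin 2) A)) := by
  let _ : Algebra (Polynomial (MvPolynomial (Fin 2) A)) (MvPolynomial (Fin 3) A) := (psi3 A).toAlgebra
  have hker : ∀ r, algebraMap (Polynomial (MvPolynomial (Fin 2) A)) (MvPolynomial (Fin 3) A) r = 0 ↔
      r ∈ Ideal.span {(Polynomial.C (X 0) * Polynomial.X + Polynomial.C (-(X 1 * X 1)) :
      Polynomial (MvPolynomial (Fin 2) A))} := by
    refine ker_of_elim (psi3 A) _ _ (X_ne_zero 0) ha ?_ psi3_inj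
    simp only [map_add, map_mul, map_neg, psi3_x, psi3_y, psi3_z]
    ring
  have hsm : ∀ (r : Polynomial (MvPolynomial (Fin 2) A)) (u : MvPolynomial (Fin 3) A), r • u = psi3 A r * u :=
    fun r u => Algebra.smul_def r u
  have h0 : ∀ r : Polynomial (MvPolynomial (Fin 2) A), IsWeightedHomogeneous w3 (algebraMap _ (MvPolynomial (Fin 3) A) r) 0 := psi3_wh
  have hz : PDL (Polynomial (MvPolynomial (Fin 2) A)) (WM w3 h0 0) 2 :=
    (pdl_WM_zero ha.ne_zero hker psi3_surj).mono (by omega)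
  have hone : PDL (Polynomial (MvPolynomial (Fin 2) A)) (WM w3 h0 1) 2 := by
    refine ses_mid (WM w3 h0 0) _ (X 0) (fun x hx => (mul_eq_zero.1 hx).resolve_left (X_ne_zero 0)) ?_
        (X 1) ?_ _ ?_ ?_ hz (pdi_two_vars 0 1 (by decide))
    · intro x hx
      exact (wX3 0).mul hx
    · exact wX3 1
    · intro r
      rw [hsm]
      constructor
      · intro hr
        obtain ⟨s, t, rfl⟩ := mem_two.1 hr
        refine ⟨psi3 A s * (X 0 * X 1 * X 2) + psi3 A t * (X 1 * X 1 * X 2), ?_, ?_⟩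
        · exact ((psi3_wh s).mul (((wX3 0).mul (wX3 1)).mul (wX3 2))).add
            ((psi3_wh t).mul (((wX3 1).mul (wX3 1)).mul (wX3 2)))
        · rw [map_add, map_mul, map_mul, psi3_x, psi3_z]; ring
      · rintro ⟨x, hx, h⟩
        exact psi3_s r x h
    · refine mono3 ?_ ?_ ?_
      · exact ⟨0, 0, Submodule.zero_mem _, by rw [hsm, map_zero]; ring⟩
      · rintro _ _ ⟨r, x, hx, rfl⟩ ⟨s, y, hy, rfl⟩
        exact ⟨r + s, x + y, Submodule.add_mem _ hx hy, by rw [hsm, hsm, hsm, map_add]; ring⟩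
      · intro c i j s h
        rcases i with _ | i
        · obtain rfl : j = 2 * s + 1 := by push_cast at h; omega
          refine ⟨Polynomial.C (C c) * Polynomial.X ^ s, 0, Submodule.zero_mem _, ?_⟩
          rw [hsm]
          simp only [map_mul, map_pow, psi3_y, psi3_c]
          ring
        · refine ⟨0, C c * X 0 ^ i * X 1 ^ j * X 2 ^ s, ?_, ?_⟩
          · rw [mem_WM]
            have := (((isWeightedHomogeneous_C w3 c).mul ((wX3 0).pow i)).mul ((wX3 1).pow j)).mul
              ((wX3 2).pow s)
            convert this using 1
            simp [w3]
            push_cast at h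
            omega
          · rw [hsm, map_zero]; ring
  have hshift : ∀ n : ℤ, n < 0 → PDL (Polynomial (MvPolynomial (Fin 2) A)) (WM w3 h0 (n + 2)) 2 →
      PDL (Polynomial (MvPolynomial (Fin 2) A)) (WM w3 h0 n) 2 := by
    intro n hn h
    refine ses_mid _ _ (X 2) (fun x hx => (mul_eq_zero.1 hx).resolve_left (X_ne_zero 2)) ?_
        0 (Submodule.zero_mem _) ⊤ ?_ ?_ h (pdi_top 2)
    · intro x hx
      have := (wX3 2).mul hx
      rw [mem_WM]
      convert this using 1
      simp [w3]
    · intro r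
      simp only [Submodule.mem_top, true_iff]
      exact ⟨0, Submodule.zero_mem _, by rw [hsm]; ring⟩
    · intro m hm
      obtain ⟨m', h1, h2⟩ := neg_v_dvd hn m hm
      exact ⟨0, m', h1, by rw [hsm, h2]; ring⟩
  have hneg : ∀ m : ℕ, PDL (Polynomial (MvPolynomial (Fin 2) A)) (WM w3 h0 (-(m : ℤ))) 2 ∧
      PDL (Polynomial (MvPolynomial (Fin 2) A)) (WM w3 h0 (-(m : ℤ) + 1)) 2 := by
    intro m
    induction m with
    | zero => simpa using ⟨hz, hone⟩
    | succ m ih =>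
      refine ⟨hshift _ (by push_cast; omega) ?_, ?_⟩
      · have e : -((m + 1 : ℕ) : ℤ) + 2 = -(m : ℤ) + 1 := by push_cast; ring
        rw [e]; exact ih.2
      · have e : -((m + 1 : ℕ) : ℤ) + 1 = -(m : ℤ) := by push_cast; ring
        rw [e]; exact ih.1
  refine cox_good (h0 := h0) ha.ne_zero hker psi3_surj ?_
  intro n β φ hβ hrel hb hf
  rcases le_or_gt 0 n with h | h
  · obtain ⟨m, rfl⟩ := Int.eq_ofNat_of_zero_le h
    exact (hneg m).1
  · exfalso
    obtain ⟨m, _, h1⟩ := neg_v_dvd h β hb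
    obtain ⟨m', _, h2⟩ := neg_v_dvd h φ hf
    have := hrel (d := X 2) ⟨m, h1⟩ ⟨m', h2⟩
    exact (X_prime (R := A) (i := (2 : Fin 3))).not_isUnit this

end R3

section Lin

lemma good_iso {P P' : Type} [CommRing P] [CommRing P'] (E : P ≃+* P') (l c q : P)
    (H : Prime (Polynomial.C (E l) * Polynomial.X + Polynomial.C (E q)) →
      Good (Polynomial.C (E l) * Polynomial.X + Polynomial.C (E q)))
    (ha : Prime (Polynomial.C l * Polynomial.X + Polynomial.C (q + l * c))) :
    Good (Polynomial.C l * Polynomial.X + Polynomial.C (q + l * c)) := by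
  let e : Polynomial P ≃+* Polynomial P' := (Polynomial.mapEquiv E).trans
    (Polynomial.algEquivAevalXAddC (-(E c))).toRingEquiv
  have he : e (Polynomial.C l * Polynomial.X + Polynomial.C (q + l * c)) =
      Polynomial.C (E l) * Polynomial.X + Polynomial.C (E q) := by
    simp [e, Polynomial.mapEquiv, Polynomial.algEquivAevalXAddC]
    ring
  apply Good.transport e
  rw [he]
  apply H
  rw [← he]
  exact (MulEquiv.prime_iff e.toMulEquiv).2 ha

variable {τ k : Type} [Field k]

lemma coord_equiv {ι : Type} (v : ι → MvPolynomial τ k) (hv : ∀ i, (v i).IsHomogeneous 1)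
    (hli : LinearIndependent k v) :
    ∃ (ρ : Type) (E : MvPolynomial τ k ≃+* MvPolynomial ι (MvPolynomial ρ k)), ∀ i, E (v i) = X i := by
  obtain ⟨ρ, e, h1, -, -⟩ := coord_exists v hv hli
  refine ⟨ρ, (e.symm.trans (sumAlgEquiv k ι ρ)).toRingEquiv, ?_⟩
  intro i
  rw [← h1]
  simp

lemma good_linear [IsAlgClosed k] [Finite τ] (l r : MvPolynomial τ k) (hl : l.IsHomogeneous 1) (hl0 : l ≠ 0)
    (hr : r.IsHomogeneous 2) (ha : Prime (Polynomial.C l * Polynomial.X + Polynomial.C r)) :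
    Good (Polynomial.C l * Polynomial.X + Polynomial.C r) := by
  obtain ⟨ρ, φ, s, h1, h2, h3, h4⟩ := lin_quot l hl hl0
  have hφl : φ l = 0 := (h2 l).2 (Ideal.mem_span_singleton_self _)
  have hφr : φ r ≠ 0 := by
    intro h
    obtain ⟨c, hc⟩ := mem_sp1.1 ((h2 r).1 h)
    have : Polynomial.C l * Polynomial.X + Polynomial.C r = Polynomial.C l * (Polynomial.X + Polynomial.C c) := by
      rw [hc, map_mul]; ring
    rcases ha.irreducible.isUnit_or_isUnit this with h | h
    · exact hom_pos_not_unit hl one_ne_zero (Polynomial.isUnit_C.1 h)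
    · exact Polynomial.not_isUnit_X_add_C c h
  by_cases hirr : Irreducible (φ r)
  · have hp : Prime (φ r) := UniqueFactorizationMonoid.irreducible_iff_prime.1 hirr
    have hpi : (Ideal.span {φ r}).IsPrime := (Ideal.span_singleton_prime hφr).2 hp
    refine Good.of_ufdi ha.ne_zero (ufdi_nagata l r hl0 ha ?_)
    have : Ideal.span {l} ⊔ Ideal.span {r} = (Ideal.span {φ r}).comap φ := by
      ext x
      rw [Ideal.mem_comap, mem_sup_span]
      constructor
      · rintro ⟨t, ht⟩
        rw [← h2, map_sub, map_mul, sub_eq_zero] at ht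
        rw [ht]
        exact mem_sp1.2 ⟨_, rfl⟩
      · intro hx
        obtain ⟨u, hu⟩ := mem_sp1.1 hx
        refine ⟨s u, ?_⟩
        rw [← h2, map_sub, map_mul, h1, hu, sub_self]
    rw [this]
    exact Ideal.comap_isPrime _ _
  · have hnu : ¬ IsUnit (φ r) := hom_pos_not_unit (h3 _ _ hr) two_ne_zero
    obtain ⟨u, v, huv, hu, hv⟩ : ∃ u v, φ r = u * v ∧ ¬ IsUnit u ∧ ¬ IsUnit v := by
      rw [irreducible_iff] at hirr
      push Not at hirr
      obtain ⟨u, v, h, h'⟩ := hirr hnu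
      exact ⟨u, v, h, h'⟩
    have huv0 : u * v ≠ 0 := by rwa [← huv]
    have hu0 := left_ne_zero_of_mul huv0
    have hv0 := right_ne_zero_of_mul huv0
    obtain ⟨i, j, hi, hj, hij⟩ := hom_factor huv0 (by rw [← huv]; exact h3 _ _ hr)
    have hi0 : i ≠ 0 := by rintro rfl; exact hu (hom_zero_unit hi hu0)
    have hj0 : j ≠ 0 := by rintro rfl; exact hv (hom_zero_unit hj hv0)
    obtain rfl : i = 1 := by omega
    obtain rfl : j = 1 := by omega
    by_cases hli : LinearIndependent k ![u, v]
    · obtain ⟨c, hc⟩ := mem_sp1.1 ((h2 (r + s u * (-(s v)))).1 (by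
        rw [map_add, map_mul, map_neg, h1, h1, huv]; ring))
      have hr' : r = -(s u * (-(s v))) + l * c := by rw [← hc]; ring
      rw [hr'] at ha ⊢
      obtain ⟨κ, E, hE⟩ := coord_equiv ![l, s u, -(s v)] (by
        intro i
        fin_cases i
        · exact hl
        · exact h4 _ _ hi
        · exact (h4 _ _ hj).neg) (by
        rw [LinearIndependent.pair_iff] at hli
        rw [Fintype.linearIndependent_iff]
        intro g hg
        simp only [Fin.sum_univ_three, Matrix.cons_val_zero, Matrix.cons_val_one, Matrix.cons_val_two,
          Matrix.cons_val, Matrix.tail_cons, Matrix.head_cons] at hg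
        have h5 := congrArg φ hg
        simp only [map_add, map_smul, map_neg, h1, hφl, smul_zero, zero_add, map_zero, smul_neg] at h5
        obtain ⟨h6, h7⟩ := hli (g 1) (-(g 2)) (by rw [neg_smul]; exact h5)
        have h7 : g 2 = 0 := by simpa using h7
        rw [h6, h7] at hg
        simp [hl0] at hg
        intro i
        fin_cases i
        · exact hg
        · exact h6
        · exact h7)
      refine good_iso E l c _ ?_ ha
      have e0 := hE 0
      have e1 := hE 1
      have e2 := hE 2
      simp only [Matrix.cons_val] at e0 e1 e2
      rw [map_neg, map_mul, e0, e1, e2]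
      exact good4
    · obtain ⟨μ, hμ⟩ : ∃ μ : k, v = C (-(μ * μ)) * u := by
        rw [LinearIndependent.pair_iff] at hli
        push Not at hli
        obtain ⟨α, β, h5, h6⟩ := hli
        have hβ : β ≠ 0 := by
          rintro rfl
          rw [zero_smul, add_zero, smul_eq_zero] at h5
          exact h6 (h5.resolve_right hu0) rfl
        obtain ⟨μ, hμ⟩ := IsAlgClosed.exists_pow_nat_eq (α / β) (n := 2) (by norm_num)
        refine ⟨μ, ?_⟩
        rw [← pow_two, hμ, ← smul_eq_C_mul]
        have : v = β⁻¹ • (β • v) := by rw [smul_smul, inv_mul_cancel₀ hβ, one_smul]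
        rw [this, eq_neg_of_add_eq_zero_right h5, smul_neg, smul_smul, neg_smul]
        congr 2
        field_simp
      have hμ0 : μ ≠ 0 := by rintro rfl; simp at hμ; exact hv0 hμ
      have hsu0 : s u ≠ 0 := by
        intro h; apply hu0; rw [← h1 u, h, map_zero]
      obtain ⟨c, hc⟩ := mem_sp1.1 ((h2 (r + (C μ * s u) * (C μ * s u))).1 (by
        have : φ (C μ) = C μ := φ.commutes μ
        rw [map_add, map_mul, map_mul, h1, huv, hμ, this, map_neg, map_mul]; ring))
      have hr' : r = -((C μ * s u) * (C μ * s u)) + l * c := by rw [← hc]; ring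
      rw [hr'] at ha ⊢
      obtain ⟨κ, E, hE⟩ := coord_equiv ![l, C μ * s u] (by
        intro i
        fin_cases i
        · exact hl
        · exact IsHomogeneous.C_mul (h4 _ _ hi) μ) (by
        rw [LinearIndependent.pair_iff]
        intro g g' hg
        have h5 := congrArg φ hg
        rw [← smul_eq_C_mul] at h5
        simp only [map_add, map_smul, h1, hφl, smul_zero, zero_add, map_zero] at h5
        have h6 : g' = 0 := by
          simpa [smul_eq_zero, hμ0, hu0] using h5
        rw [h6] at hg
        simp [hl0] at hg
        exact ⟨hg, h6⟩)
      refine good_iso E l c _ ?_ ha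
      have e0 := hE 0
      have e1 := hE 1
      simp only [Matrix.cons_val] at e0 e1
      rw [map_neg, map_mul, e0, e1]
      exact good3

end Lin

section Quad
variable {σ k : Type} [Field k]

lemma quad_dich [IsAlgClosed k] {V : Type} [AddCommGroup V] [Module k V] (B : V →ₗ[k] V →ₗ[k] k)
    {ι : Type} [Fintype ι] (e : ι → V)
    (H : ∀ p, B p p = 0 → ∀ v, B p v + B v p = 0) :
    ∃ (q : k) (t : ι → k), ∀ x : ι → k, B (∑ i, x i • e i) (∑ i, x i • e i) = q * (∑ i, t i * x i) ^ 2 := by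
  by_cases hu : ∀ u, B u u = 0
  · exact ⟨0, 0, fun x => by rw [hu]; simp⟩
  push Not at hu
  obtain ⟨u, hu⟩ := hu
  have hroot : ∀ i, ∃ t : k, B (e i + t • u) (e i + t • u) = 0 := by
    intro i
    let f : Polynomial k := Polynomial.C (B u u) * Polynomial.X ^ 2 +
      Polynomial.C (B (e i) u + B u (e i)) * Polynomial.X + Polynomial.C (B (e i) (e i))
    have hf : f.degree ≠ 0 := by
      rw [Polynomial.degree_quadratic hu]; decide
    obtain ⟨t, ht⟩ := IsAlgClosed.exists_root f hf
    refine ⟨t, ?_⟩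
    simp only [Polynomial.IsRoot.def, f, Polynomial.eval_add, Polynomial.eval_mul, Polynomial.eval_C,
      Polynomial.eval_pow, Polynomial.eval_X] at ht
    simp only [map_add, LinearMap.add_apply, map_smul, LinearMap.smul_apply, smul_eq_mul]
    linear_combination ht
  choose t ht using hroot
  refine ⟨B u u, t, fun x => ?_⟩
  set p : ι → V := fun i => e i + t i • u with hp
  have hpp : ∀ i v, B (p i) v + B v (p i) = 0 := fun i v => H _ (ht i) v
  set w := ∑ i, x i • p i with hw
  have hwv : ∀ v, B w v + B v w = 0 := by
    intro v
    simp only [hw, map_sum, map_smul, LinearMap.sum_apply, LinearMap.smul_apply, ← Finset.sum_add_distrib,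
      ← smul_add, hpp, smul_zero, Finset.sum_const_zero]
  have hww : B w w = 0 := by
    have key : ∀ s : Finset ι, B (∑ i ∈ s, x i • p i) (∑ i ∈ s, x i • p i) = 0 := by
      classical
      intro s
      induction s using Finset.induction_on with
      | empty => simp
      | insert i s hi ih =>
        rw [Finset.sum_insert hi]
        have h1 := ht i
        have h2 := hpp i (∑ i ∈ s, x i • p i)
        simp only [map_add, LinearMap.add_apply, map_smul, LinearMap.smul_apply, ih]
        simp only [smul_eq_mul]
        linear_combination (x i * x i) * h1 + x i * h2
    exact key _
  have hv : ∑ i, x i • e i = w - (∑ i, t i * x i) • u := by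
    rw [hw, Finset.sum_smul, ← Finset.sum_sub_distrib]
    refine Finset.sum_congr rfl fun i _ => ?_
    rw [hp]; simp only [smul_add, smul_smul]
    rw [mul_comm (x i)]; abel
  rw [hv]
  generalize (∑ i, t i * x i) = y
  simp only [map_sub, LinearMap.sub_apply, map_smul, LinearMap.smul_apply, smul_eq_mul, hww]
  linear_combination (-y) * hwv u

/-- the bilinear form with matrix `c` -/
def blf [Fintype σ] (c : σ → σ → k) : (σ → k) →ₗ[k] (σ → k) →ₗ[k] k :=
  LinearMap.mk₂ k (fun p v => ∑ i, ∑ j, c i j * (p i * v j))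
    (by intro a b d; simp [add_mul, mul_add, Finset.sum_add_distrib])
    (by intro a b d; simp only [Pi.smul_apply, smul_eq_mul, Finset.mul_sum]
        exact Finset.sum_congr rfl fun i _ => Finset.sum_congr rfl fun j _ => by ring)
    (by intro a b d; simp [mul_add, Finset.sum_add_distrib])
    (by intro a b d; simp only [Pi.smul_apply, smul_eq_mul, Finset.mul_sum]
        exact Finset.sum_congr rfl fun i _ => Finset.sum_congr rfl fun j _ => by ring)

lemma blf_apply [Fintype σ] (c : σ → σ → k) (p v : σ → k) :
    blf c p v = ∑ i, ∑ j, c i j * (p i * v j) := rfl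

lemma deg_one_single (d : σ →₀ ℕ) (h : d.degree = 1) : ∃ i, d = Finsupp.single i 1 := by
  classical
  have hne : d ≠ 0 := by rintro rfl; simp at h
  obtain ⟨i, hi⟩ := Finsupp.ne_iff.1 hne
  have hle : Finsupp.single i 1 ≤ d := by
    rw [Finsupp.single_le_iff]; exact Nat.one_le_iff_ne_zero.2 hi
  obtain ⟨d', rfl⟩ := exists_add_of_le hle
  rw [map_add, Finsupp.degree_single] at h
  have : d'.degree = 0 := by omega
  rw [Finsupp.degree_eq_zero_iff] at this
  exact ⟨i, by rw [this, add_zero]⟩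

lemma deg_two_single (d : σ →₀ ℕ) (h : d.degree = 2) :
    ∃ i j, d = Finsupp.single i 1 + Finsupp.single j 1 := by
  classical
  have hne : d ≠ 0 := by rintro rfl; simp at h
  obtain ⟨i, hi⟩ := Finsupp.ne_iff.1 hne
  have hle : Finsupp.single i 1 ≤ d := by
    rw [Finsupp.single_le_iff]; exact Nat.one_le_iff_ne_zero.2 hi
  obtain ⟨d', rfl⟩ := exists_add_of_le hle
  rw [map_add, Finsupp.degree_single] at h
  obtain ⟨j, rfl⟩ := deg_one_single d' (by omega)
  exact ⟨i, j, rfl⟩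

lemma quad_matrix [Fintype σ] (a : MvPolynomial σ k) (ha : a.IsHomogeneous 2) :
    ∃ c : σ → σ → k, a = ∑ i, ∑ j, C (c i j) * (X i * X j) := by
  classical
  rw [← support_sum_monomial_coeff a]
  refine Finset.sum_induction _ (fun a => ∃ c : σ → σ → k, a = ∑ i, ∑ j, C (c i j) * (X i * X j)) ?_ ?_ ?_
  · rintro _ _ ⟨c, rfl⟩ ⟨c', rfl⟩
    refine ⟨fun i j => c i j + c' i j, ?_⟩
    simp [add_mul, Finset.sum_add_distrib]
  · exact ⟨0, by simp⟩
  · intro d hd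
    have h1 : d.degree = 2 := by
      have := ha (mem_support_iff.1 hd)
      rwa [Finsupp.degree_eq_weight_one]
    obtain ⟨i, j, rfl⟩ := deg_two_single d h1
    generalize coeff _ a = q
    refine ⟨fun i' j' => if i' = i then (if j' = j then q else 0) else 0, ?_⟩
    rw [Finset.sum_eq_single i, Finset.sum_eq_single j]
    · simp only [if_true, X, C_mul_monomial, monomial_mul, one_mul, mul_one]
    · intro j' _ hj'; simp [hj']
    · simp
    · intro i' _ hi'; simp [hi']
    · simp

end Quad

section GoodQuad
variable {σ k : Type} [Field k]

lemma eval_quad [Fintype σ] (c : σ → σ → k) (v : σ → k) :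
    eval v (∑ i, ∑ j, C (c i j) * (X i * X j)) = blf c v v := by
  simp [blf_apply]

lemma hom_sum_sum [Fintype σ] {τ : Type} (n : ℕ) (f : σ → σ → MvPolynomial τ k)
    (h : ∀ i j, (f i j).IsHomogeneous n) : (∑ i, ∑ j, f i j).IsHomogeneous n :=
  IsHomogeneous.sum _ _ _ fun i _ => IsHomogeneous.sum _ _ _ fun j _ => h i j

/-- project from the point `p` (with `p j = 1`) -/
def projY [DecidableEq σ] (j i : σ) : MvPolynomial {i : σ // i ≠ j} k :=
  if h : i = j then 0 else X ⟨i, h⟩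

lemma projY_hom [DecidableEq σ] (j i : σ) : (projY (k := k) j i).IsHomogeneous 1 := by
  unfold projY
  split
  · exact isHomogeneous_zero _ _ _
  · exact isHomogeneous_X _ _

/-- the forward map -/
def projF [DecidableEq σ] (j : σ) (p : σ → k) :
    MvPolynomial σ k →+* Polynomial (MvPolynomial {i : σ // i ≠ j} k) :=
  (aeval (fun i => Polynomial.C (projY j i) + Polynomial.C (C (p i)) * Polynomial.X) :
    MvPolynomial σ k →ₐ[k] _).toRingHom

lemma projF_X [DecidableEq σ] (j : σ) (p : σ → k) (i : σ) :
    projF j p (X i) = Polynomial.C (projY j i) + Polynomial.C (C (p i)) * Polynomial.X := by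
  simp [projF]

lemma projF_C [DecidableEq σ] (j : σ) (p : σ → k) (c : k) :
    projF j p (C c) = Polynomial.C (C c) := by
  simp [projF]

/-- the projection as an isomorphism -/
def projE [DecidableEq σ] (j : σ) (p : σ → k) (hp : p j = 1) :
    MvPolynomial σ k ≃+* Polynomial (MvPolynomial {i : σ // i ≠ j} k) :=
  RingEquiv.ofRingHom (projF j p)
    (psi (A := k) (fun i : {i : σ // i ≠ j} => X i.1 - C (p i.1) * X j) (X j))
    (by
      apply Polynomial.ringHom_ext'
      · apply MvPolynomial.ringHom_ext
        · intro c
          simp only [RingHom.comp_apply, psi_CC, algebraMap_eq, projF_C, RingHom.id_apply]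
        · intro i
          simp only [RingHom.comp_apply, psi_CX, map_sub, map_mul, projF_C, projF_X, RingHom.id_apply, hp]
          simp [projY, i.2]
      · simp only [RingHom.comp_apply, psi_X, projF_X, RingHom.id_apply, hp]
        simp [projY])
    (by
      apply MvPolynomial.ringHom_ext
      · intro c
        simp only [RingHom.comp_apply, psi_CC, algebraMap_eq, projF_C, RingHom.id_apply]
      · intro i
        simp only [RingHom.comp_apply, projF_X, RingHom.id_apply, map_add, map_mul, psi_CC, psi_X, algebraMap_eq]
        by_cases h : i = j
        · subst h; simp [projY, hp]
        · rw [projY, dif_neg h, psi_CX]; ring)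

lemma projE_apply [DecidableEq σ] (j : σ) (p : σ → k) (hp : p j = 1) (a : MvPolynomial σ k) :
    projE j p hp a = projF j p a := rfl

lemma good_quad_pt [IsAlgClosed k] [Fintype σ] (c : σ → σ → k)
    (hpr : Prime (∑ i, ∑ j, C (c i j) * (X i * X j) : MvPolynomial σ k))
    (p : σ → k) (j : σ) (hp : p j = 1) (hpp : blf c p p = 0) (v : σ → k)
    (hv : blf c p v + blf c v p ≠ 0) :
    Good (∑ i, ∑ j, C (c i j) * (X i * X j) : MvPolynomial σ k) := by
  classical
  set a : MvPolynomial σ k := ∑ i, ∑ j, C (c i j) * (X i * X j) with ha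
  set l : MvPolynomial {i : σ // i ≠ j} k :=
    ∑ i, ∑ i', C (c i i') * (C (p i) * projY j i' + C (p i') * projY j i) with hl
  set r : MvPolynomial {i : σ // i ≠ j} k :=
    ∑ i, ∑ i', C (c i i') * (projY j i * projY j i') with hr
  have key : projE j p hp a = Polynomial.C l * Polynomial.X + Polynomial.C r := by
    have h0 : (Polynomial.C (C (blf c p p)) : Polynomial (MvPolynomial {i : σ // i ≠ j} k)) * Polynomial.X ^ 2 = 0 := by
      rw [hpp]; simp
    rw [← add_zero (_ + Polynomial.C r), ← h0, projE_apply, ha, hl, hr, blf_apply]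
    simp only [map_sum, map_mul, projF_X, projF_C, Finset.sum_mul, ← Finset.sum_add_distrib, map_add]
    exact Finset.sum_congr rfl fun i _ => Finset.sum_congr rfl fun i' _ => by ring
  refine Good.transport (projE j p hp) ?_
  have hpr' : Prime (projE j p hp a) := (MulEquiv.prime_iff (projE j p hp).toMulEquiv).2 hpr
  rw [key] at hpr' ⊢
  refine good_linear l r ?_ ?_ ?_ hpr'
  · refine hom_sum_sum 1 _ fun i i' => ?_
    rw [← zero_add 1]
    refine (isHomogeneous_C _ _).mul (IsHomogeneous.add ?_ ?_) <;>
    · rw [← zero_add 1]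
      exact (isHomogeneous_C _ _).mul (projY_hom _ _)
  · intro h0
    apply hv
    set v' : σ → k := v - v j • p with hv'
    have hv'j : v' j = 0 := by simp [hv', hp]
    have h1 : eval (fun i : {i : σ // i ≠ j} => v' i.1) l = blf c p v' + blf c v' p := by
      have hy : ∀ i, eval (fun i : {i : σ // i ≠ j} => v' i.1) (projY j i) = v' i := by
        intro i
        by_cases h : i = j
        · subst h; simp [projY, hv'j]
        · rw [projY, dif_neg h, eval_X]
      rw [hl, blf_apply, blf_apply]
      simp only [map_sum, map_mul, map_add, eval_C, hy, ← Finset.sum_add_distrib]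
      exact Finset.sum_congr rfl fun i _ => Finset.sum_congr rfl fun i' _ => by ring
    rw [h0, map_zero] at h1
    rw [hv'] at h1
    simp only [map_sub, map_smul, LinearMap.sub_apply, LinearMap.smul_apply, hpp, smul_zero, sub_zero] at h1
    exact h1.symm
  · refine hom_sum_sum 2 _ fun i i' => ?_
    rw [← zero_add 2]
    exact (isHomogeneous_C _ _).mul ((projY_hom _ _).mul (projY_hom _ _))

lemma good_quad [IsAlgClosed k] [Fintype σ] (a : MvPolynomial σ k) (ha : a.IsHomogeneous 2)
    (hpr : Prime a) : Good a := by
  classical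
  obtain ⟨c, rfl⟩ := quad_matrix a ha
  by_cases H : ∀ p, blf c p p = 0 → ∀ v, blf c p v + blf c v p = 0
  · exfalso
    obtain ⟨q, t, hqt⟩ := quad_dich (blf c) (fun i : σ => (Pi.single i 1 : σ → k)) H
    have hx : ∀ x : σ → k, ∑ i, x i • (Pi.single i 1 : σ → k) = x := by
      intro x; ext i; simp [Pi.single_apply]
    have hL : (∑ i, C (t i) * X i : MvPolynomial σ k).IsHomogeneous 1 :=
      IsHomogeneous.sum _ _ _ fun i _ => by
        rw [← zero_add 1]; exact (isHomogeneous_C _ _).mul (isHomogeneous_X _ _)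
    have heq : (∑ i, ∑ j, C (c i j) * (X i * X j) : MvPolynomial σ k) =
        (C q * ∑ i, C (t i) * X i) * ∑ i, C (t i) * X i := by
      apply MvPolynomial.funext
      intro x
      rw [eval_quad]
      have := hqt x
      rw [hx] at this
      rw [this]
      simp only [map_mul, map_sum, eval_C, eval_X]
      ring
    rcases hpr.irreducible.isUnit_or_isUnit heq with h | h
    · exact hom_pos_not_unit hL one_ne_zero (isUnit_of_mul_isUnit_right h)
    · exact hom_pos_not_unit hL one_ne_zero h
  · push Not at H
    obtain ⟨p, hpp, v, hv⟩ := H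
    have hp0 : p ≠ 0 := by rintro rfl; simp at hv
    obtain ⟨j, hj⟩ := Function.ne_iff.1 hp0
    have hj : p j ≠ 0 := hj
    refine good_quad_pt c hpr ((p j)⁻¹ • p) j (by simp [hj]) (by simp [hpp]) v ?_
    simp only [map_smul, LinearMap.smul_apply, ← smul_add]
    exact smul_ne_zero (inv_ne_zero hj) hv

end GoodQuad

section Top
variable {R : Type} [CommRing R]

lemma height_bot_le [IsDomain R] (y : {q : Ideal R // q.IsPrime}) (h : y.1 = ⊥) : Order.height y = 0 := by
  rw [Order.height_eq_zero]
  intro z _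
  rw [← Subtype.coe_le_coe, h]
  exact bot_le

lemma height_span_prime [IsDomain R] [UniqueFactorizationMonoid R] (p : R) (hp : Prime p)
    (x : {q : Ideal R // q.IsPrime}) (hx : x.1 = Ideal.span {p}) : Order.height x ≤ 1 := by
  have : ((1 : ℕ) : ℕ∞) = 1 := rfl
  rw [← this, Order.height_le_coe_iff]
  intro y hy
  rw [height_bot_le y ?_]
  · exact_mod_cast Nat.zero_lt_one
  rw [Submodule.eq_bot_iff]
  by_contra! hcon
  obtain ⟨z, hz, hz0⟩ := hcon
  have hlt : y.1 < Ideal.span {p} := by rw [← hx]; exact hy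
  have hpy : p ∉ y.1 := fun h => hlt.not_ge ((Ideal.span_singleton_le_iff_mem _).2 h)
  obtain ⟨n, w, hw, rfl⟩ := WfDvdMonoid.max_power_factor hz0 hp.irreducible
  rcases y.2.mem_or_mem hz with h | h
  · exact hpy (y.2.mem_of_pow_mem n h)
  · exact hw (Ideal.mem_span_singleton.1 (hlt.le h))

lemma not_le_of_height [IsDomain R] [UniqueFactorizationMonoid R] {J : Ideal R} (h : idealHeight J = 2)
    (p : R) (hp : Prime p) : ¬ J ≤ Ideal.span {p} := by
  intro hle
  have hpp : (Ideal.span {p}).IsPrime := (Ideal.span_singleton_prime hp.ne_zero).2 hp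
  have h1 : idealHeight J ≤ Order.height (⟨Ideal.span {p}, hpp⟩ : {q : Ideal R // q.IsPrime}) :=
    iInf₂_le (⟨Ideal.span {p}, hpp⟩ : {q : Ideal R // q.IsPrime}) (show J ≤ Ideal.span {p} from hle)
  have h2 := h1.trans (height_span_prime p hp _ rfl)
  rw [h] at h2
  exact absurd h2 (by decide)

lemma ne_bot_of_height [IsDomain R] {J : Ideal R} (h : idealHeight J = 2) : J ≠ ⊥ := by
  intro hle
  have h1 : idealHeight J ≤ Order.height (⟨⊥, Ideal.isPrime_bot⟩ : {q : Ideal R // q.IsPrime}) :=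
    iInf₂_le (⟨⊥, Ideal.isPrime_bot⟩ : {q : Ideal R // q.IsPrime}) (show J ≤ ⊥ from hle.le)
  rw [height_bot_le _ rfl, h] at h1
  exact absurd h1 (by decide)

lemma span_triple (a b c : R) : Ideal.span {a, b, c} = Ideal.span {a} ⊔ Ideal.span {b} ⊔ Ideal.span {c} := by
  rw [Ideal.span_insert, Ideal.span_insert, sup_assoc]

variable {σ k : Type} [Field k]

lemma colon_pdi [IsAlgClosed k] [Fintype σ] (a b f : MvPolynomial σ k) (d : ℕ) (hd : d ≤ 2)
    (ha : a.IsHomogeneous d) (ha0 : a ≠ 0) (hb : b.IsHomogeneous d) (hab : IsRelPrime a b) :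
    PDI (colon1 (Ideal.span {a} ⊔ Ideal.span {b}) f) 3 := by
  by_cases hu : IsUnit a
  · have : colon1 (Ideal.span {a} ⊔ Ideal.span {b}) f = ⊤ := by
      rw [Ideal.span_singleton_eq_top.2 hu, top_sup_eq]
      ext x; simp [mem_colon1]
    rw [this]; exact pdi_top 3
  have hb' : ∀ q, q ∣ a → ¬ IsUnit q → b ∉ Ideal.span {q} := fun q hq hqu h =>
    hqu (hab hq (Ideal.mem_span_singleton.1 h))
  interval_cases d
  · exact absurd (hom_zero_unit ha ha0) hu
  · exact Good.of_ufdi ha0 (ufdi_lin ha ha0) b f (hb' a dvd_rfl hu) _ fun x => mem_colon1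
  · by_cases hirr : Irreducible a
    · exact good_quad a ha hirr.prime b f (hb' a dvd_rfl hu) _ fun x => mem_colon1
    · rw [irreducible_iff] at hirr
      push Not at hirr
      obtain ⟨l, m, rfl, hl, hm⟩ := hirr hu
      have hl0 := left_ne_zero_of_mul ha0
      have hm0 := right_ne_zero_of_mul ha0
      obtain ⟨i, j, hi, hj, hij⟩ := hom_factor ha0 ha
      have hi0 : i ≠ 0 := by rintro rfl; exact hl (hom_zero_unit hi hl0)
      have hj0 : j ≠ 0 := by rintro rfl; exact hm (hom_zero_unit hj hm0)
      obtain rfl : i = 1 := by omega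
      obtain rfl : j = 1 := by omega
      exact reducible_case hi hl0 hj hm0 hb (hb' l (dvd_mul_right _ _) hl) (hb' m (dvd_mul_left _ _) hm)
        fun x => mem_colon1

lemma core [IsAlgClosed k] [Fintype σ] (f₁ f₂ f₃ g : MvPolynomial σ k)
    (hf₁ : f₁.IsHomogeneous 3) (hf₂ : f₂.IsHomogeneous 3)
    (hI : idealHeight (Ideal.span {f₁, f₂, f₃}) = 2) (hg : ¬ IsUnit g)
    (h1 : g ∣ f₁) (h2 : g ∣ f₂) (h0 : f₁ ≠ 0) : PDI (Ideal.span {f₁, f₂, f₃}) 4 := by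
  obtain ⟨a, b, c, rfl, rfl, ha0, hc0, hab⟩ := ufd_reduce f₁ f₂ h0
  have hc : ¬ IsUnit c := fun hu => hg (hab (hu.dvd_mul_right.1 h1) (hu.dvd_mul_right.1 h2))
  obtain ⟨d, i, had, hci, hdi⟩ := hom_factor h0 hf₁
  have hi0 : i ≠ 0 := by rintro rfl; exact hc (hom_zero_unit hci hc0)
  have hbd : b.IsHomogeneous d := by
    by_cases hb0 : b = 0
    · rw [hb0]; exact isHomogeneous_zero _ _ _
    obtain ⟨d', i', hbd, hci', hdi'⟩ := hom_factor (mul_ne_zero hb0 hc0) hf₂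
    have := hci.inj_right hci' hc0
    obtain rfl : d' = d := by omega
    exact hbd
  have hcf : IsRelPrime c f₃ := by
    rw [UniqueFactorizationMonoid.isRelPrime_iff_no_prime_factors hc0]
    intro p hpc hpf hp
    refine not_le_of_height hI p hp ?_
    rw [Ideal.span_le]
    rintro x (rfl | rfl | rfl)
    · exact Ideal.mem_span_singleton.2 (hpc.mul_left _)
    · exact Ideal.mem_span_singleton.2 (hpc.mul_left _)
    · exact Ideal.mem_span_singleton.2 hpf
  rw [span_triple]
  refine pdi_mid (K := Ideal.span {a} ⊔ Ideal.span {b} ⊔ Ideal.span {f₃}) c ?_ ?_ ?_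
  · intro x
    rw [mem_three, mem_three]
    constructor
    · rintro ⟨u, v, w, rfl⟩
      exact ⟨u, v, c * w, by ring⟩
    · rintro ⟨u, v, w, h⟩
      have : c ∣ f₃ * w := ⟨x - a * u - b * v, by linear_combination -h⟩
      obtain ⟨w', rfl⟩ := hcf.dvd_of_dvd_mul_left this
      exact ⟨u, v, w', mul_left_cancel₀ hc0 (by linear_combination h)⟩
  · refine pdi_right f₃ (fun x => mem_colon1) (colon_pdi a b f₃ d (by omega) had ha0 hbd hab) ?_
    refine (pdi_regular b (fun x hx => ?_) (pdi_span_singleton a ha0)).mono (by omega)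
    rw [Ideal.mem_span_singleton] at hx ⊢
    exact hab.dvd_of_dvd_mul_left hx
  · have : Ideal.span {a * c} ⊔ Ideal.span {b * c} ⊔ Ideal.span {f₃} ⊔ Ideal.span {c} =
        Ideal.span {c} ⊔ Ideal.span {f₃} := by
      apply le_antisymm
      · refine sup_le (sup_le (sup_le ?_ ?_) le_sup_right) le_sup_left
        · exact le_sup_of_le_left (Ideal.span_singleton_le_span_singleton.2 (dvd_mul_left _ _))
        · exact le_sup_of_le_left (Ideal.span_singleton_le_span_singleton.2 (dvd_mul_left _ _))
      · exact sup_le le_sup_right (le_sup_of_le_left le_sup_right)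
    rw [this]
    refine (pdi_regular f₃ (fun x hx => ?_) (pdi_span_singleton c hc0)).mono (by omega)
    rw [Ideal.mem_span_singleton] at hx ⊢
    exact hcf.dvd_of_dvd_mul_left hx

end Top

theorem statement_6
    {k : Type} [Field k] [IsAlgClosed k] {N : ℕ}
    (f₁ f₂ f₃ : MvPolynomial (Fin N) k)
    (hf₁ : f₁.IsHomogeneous 3) (hf₂ : f₂.IsHomogeneous 3) (hf₃ : f₃.IsHomogeneous 3)
    (hIht : idealHeight (Ideal.span {f₁, f₂, f₃}) = 2)
    (hht₁₂ : idealHeight (Ideal.span {f₁, f₂}) = 2)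
    (hht₁₃ : idealHeight (Ideal.span {f₁, f₃}) = 2)
    (hht₂₃ : idealHeight (Ideal.span {f₂, f₃}) = 2)
    (g : MvPolynomial (Fin N) k) (hg : ¬ IsUnit g)
    (f₁' f₂' f₃' : MvPolynomial (Fin N) k)
    (hf₁' : f₁'.IsHomogeneous 3) (hf₂' : f₂'.IsHomogeneous 3) (hf₃' : f₃'.IsHomogeneous 3)
    (hIeq : Ideal.span {f₁', f₂', f₃'} = Ideal.span {f₁, f₂, f₃})
    (hsub : Ideal.span {f₁', f₂'} ≤ Ideal.span {g}) :
    pdQuotLE (Ideal.span {f₁, f₂, f₃}) 4 := by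
  apply PDI.pdQuotLE
  rw [← hIeq] at hIht ⊢
  have h1 : g ∣ f₁' := Ideal.mem_span_singleton.1 (hsub (Ideal.subset_span (by simp)))
  have h2 : g ∣ f₂' := Ideal.mem_span_singleton.1 (hsub (Ideal.subset_span (by simp)))
  by_cases h0 : f₁' = 0
  · by_cases h0' : f₂' = 0
    · exfalso
      subst h0; subst h0'
      have hs : Ideal.span {0, 0, f₃'} = Ideal.span {f₃'} := by
        rw [span_triple]; simp
      rw [hs] at hIht
      by_cases h3 : f₃' = 0
      · exact ne_bot_of_height hIht (by rw [h3]; simp)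
      · obtain ⟨p, hp, hpd⟩ := WfDvdMonoid.exists_irreducible_factor
          (hom_pos_not_unit hf₃' (by decide)) h3
        exact not_le_of_height hIht p hp.prime (Ideal.span_singleton_le_span_singleton.2 hpd)
    · rw [Set.insert_comm] at hIht ⊢
      exact core f₂' f₁' f₃' g hf₂' hf₁' hIht hg h2 h1 h0'
  · exact core f₁' f₂' f₃' g hf₁' hf₂' hIht hg h1 h2 h0

end
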